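/- arXiv:2510.12464 — 5 statements merged into one kernel-verified Lean document; each statement's English description precedes it below -/
import Mathlib

section
/- Let θ ∈ (0,1] and define the linearized collision operator L_θ h = −2 M_s^{−1} [ θ Q_s(M_s, M_s h) + (1−θ) Q_r(M_s, M_s h) ]. Then for all measurable h, g : ℝ³ × (0,∞) → ℝ such that all the integrals below converge absolutely, L_θ is symmetric and nonnegative with respect to the weighted inner product: ∫_{ℝ³×[0,∞)} (L_θ h)(ξ,I) g(ξ,I) M_s(ξ,I) dξ dI = ∫_{ℝ³×[0,∞)} h(ξ,I) (L_θ g)(ξ,I) M_s(ξ,I) dξ dI, and ∫_{ℝ³×[0,∞)} (L_θ h)(ξ,I) h(ξ,I) M_s(ξ,I) dξ dI ≥ 0. -/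
noncomputable section

open MeasureTheory Real
open scoped BigOperators RealInnerProductSpace

abbrev V3 : Type := EuclideanSpace ℝ (Fin 3)

abbrev Sph : Type := Metric.sphere (0 : V3) 1

/-- The surface measure on the unit sphere `S²` (total mass `4π`). -/
def sphMeasure : Measure Sph := (volume : Measure V3).toSphere

/-- The measure `dξ dI` on `ℝ³ × [0,∞)`. -/
def phaseMeasure : Measure (V3 × ℝ) :=
  (volume : Measure V3).prod ((volume : Measure ℝ).restrict (Set.Ici 0))

/-- Total energy `E = (m/4)|ξ−ξ_*|² + I + I_*` in the center-of-mass frame. -/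
def collE (m : ℝ) (ξ ξs : V3) (I Is : ℝ) : ℝ :=
  m / 4 * ‖ξ - ξs‖ ^ 2 + I + Is

/-- Post-collisional velocity `ξ'` for standard (Borgnakke–Larsen) collisions. -/
def xiPrimeStd (m : ℝ) (ξ ξs : V3) (I Is R : ℝ) (σ : Sph) : V3 :=
  (1 / 2 : ℝ) • (ξ + ξs) + Real.sqrt (R * collE m ξ ξs I Is / m) • (σ : V3)

/-- Post-collisional velocity `ξ_*'` for standard collisions. -/
def xiStarPrimeStd (m : ℝ) (ξ ξs : V3) (I Is R : ℝ) (σ : Sph) : V3 :=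
  (1 / 2 : ℝ) • (ξ + ξs) - Real.sqrt (R * collE m ξ ξs I Is / m) • (σ : V3)

/-- Post-collisional internal energy `I' = r(1−R)E` for standard collisions. -/
def IPrimeStd (m : ℝ) (ξ ξs : V3) (I Is R r : ℝ) : ℝ :=
  r * (1 - R) * collE m ξ ξs I Is

/-- Post-collisional internal energy `I_*' = (1−r)(1−R)E` for standard collisions. -/
def IStarPrimeStd (m : ℝ) (ξ ξs : V3) (I Is R r : ℝ) : ℝ :=
  (1 - r) * (1 - R) * collE m ξ ξs I Is

/-- Integrand of the standard collision operator `Q_s`. -/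
def stdIntegrand (m δ α β Cs : ℝ) (f F : V3 → ℝ → ℝ)
    (ξ : V3) (I : ℝ) (ξs : V3) (Is : ℝ) (σ : Sph) (r R : ℝ) : ℝ :=
  ((f (xiPrimeStd m ξ ξs I Is R σ) (IPrimeStd m ξ ξs I Is R r) *
        F (xiStarPrimeStd m ξ ξs I Is R σ) (IStarPrimeStd m ξ ξs I Is R r) +
      f (xiStarPrimeStd m ξ ξs I Is R σ) (IStarPrimeStd m ξ ξs I Is R r) *
        F (xiPrimeStd m ξ ξs I Is R σ) (IPrimeStd m ξ ξs I Is R r)) /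
      (IPrimeStd m ξ ξs I Is R r * IStarPrimeStd m ξ ξs I Is R r) ^ (δ / 2 - 1) -
    (f ξ I * F ξs Is + f ξs Is * F ξ I) / (I * Is) ^ (δ / 2 - 1)) *
  (Cs * (I + Is) ^ α * ‖ξ - ξs‖ ^ β * (I * Is) ^ (δ / 2 - 1) *
    (r * (1 - r)) ^ (δ / 2 - 1) * (1 - R) ^ (α + δ - 1) * R ^ ((β + 1) / 2))

/-- The standard (inelastic) collision operator `Q_s(f,F)`. -/
def Qs (m δ α β Cs : ℝ) (f F : V3 → ℝ → ℝ) (ξ : V3) (I : ℝ) : ℝ :=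
  (1 / 2) * ∫ Is in Set.Ici (0 : ℝ), ∫ ξs : V3,
    (∫ σ : Sph, (∫ r in Set.Icc (0 : ℝ) 1, ∫ R in Set.Icc (0 : ℝ) 1,
      stdIntegrand m δ α β Cs f F ξ I ξs Is σ r R) ∂sphMeasure)

/-- Post-collisional velocity `ξ'` for resonant collisions. -/
def xiPrimeRes (ξ ξs : V3) (σ : Sph) : V3 :=
  (1 / 2 : ℝ) • (ξ + ξs) + (‖ξ - ξs‖ / 2) • (σ : V3)

/-- Post-collisional velocity `ξ_*'` for resonant collisions. -/
def xiStarPrimeRes (ξ ξs : V3) (σ : Sph) : V3 :=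
  (1 / 2 : ℝ) • (ξ + ξs) - (‖ξ - ξs‖ / 2) • (σ : V3)

/-- Post-collisional internal energy `I' = r(I+I_*)` for resonant collisions. -/
def IPrimeRes (I Is r : ℝ) : ℝ := r * (I + Is)

/-- Post-collisional internal energy `I_*' = (1−r)(I+I_*)` for resonant collisions. -/
def IStarPrimeRes (I Is r : ℝ) : ℝ := (1 - r) * (I + Is)

/-- Integrand of the resonant collision operator `Q_r`. -/
def resIntegrand (δ α β Cr : ℝ) (f F : V3 → ℝ → ℝ)
    (ξ : V3) (I : ℝ) (ξs : V3) (Is : ℝ) (σ : Sph) (r : ℝ) : ℝ :=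
  ((f (xiPrimeRes ξ ξs σ) (IPrimeRes I Is r) * F (xiStarPrimeRes ξ ξs σ) (IStarPrimeRes I Is r) +
      f (xiStarPrimeRes ξ ξs σ) (IStarPrimeRes I Is r) * F (xiPrimeRes ξ ξs σ) (IPrimeRes I Is r)) /
      (IPrimeRes I Is r * IStarPrimeRes I Is r) ^ (δ / 2 - 1) -
    (f ξ I * F ξs Is + f ξs Is * F ξ I) / (I * Is) ^ (δ / 2 - 1)) *
  (Cr * (I + Is) ^ α * ‖ξ - ξs‖ ^ β * (I * Is) ^ (δ / 2 - 1) * (r * (1 - r)) ^ (δ / 2 - 1))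

/-- The resonant (elastic) collision operator `Q_r(f,F)`. -/
def Qr (δ α β Cr : ℝ) (f F : V3 → ℝ → ℝ) (ξ : V3) (I : ℝ) : ℝ :=
  (1 / 2) * ∫ Is in Set.Ici (0 : ℝ), ∫ ξs : V3,
    (∫ σ : Sph, (∫ r in Set.Icc (0 : ℝ) 1,
      resIntegrand δ α β Cr f F ξ I ξs Is σ r) ∂sphMeasure)

/-- The Maxwellian equilibrium distribution `M_s`. -/
def Ms (m kB δ n T : ℝ) (u : V3) (ξ : V3) (I : ℝ) : ℝ :=
  n * I ^ (δ / 2 - 1) /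
      ((2 * π * kB * T / m) ^ ((3 : ℝ) / 2) * (kB * T) ^ (δ / 2) * Real.Gamma (δ / 2)) *
    Real.exp (-(m * ‖ξ - u‖ ^ 2 + 2 * I) / (2 * kB * T))

/-- The two-temperature equilibrium distribution `M_r`. -/
def Mr (m kB δ n Ttr Tint : ℝ) (u : V3) (ξ : V3) (I : ℝ) : ℝ :=
  n * I ^ (δ / 2 - 1) /
      ((2 * π * kB * Ttr / m) ^ ((3 : ℝ) / 2) * (kB * Tint) ^ (δ / 2) * Real.Gamma (δ / 2)) *
    Real.exp (-(m * ‖ξ - u‖ ^ 2) / (2 * kB * Ttr) - I / (kB * Tint))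

/-- Integrand of the resonant linearized collision operator `L_r`. -/
def LrIntegrand (m kB δ n Ttr Tint α β : ℝ) (u : V3) (h : V3 → ℝ → ℝ)
    (ξ : V3) (I : ℝ) (Is : ℝ) (ξs : V3) (σ : Sph) (r : ℝ) : ℝ :=
  Mr m kB δ n Ttr Tint u ξs Is *
    (h (xiStarPrimeRes ξ ξs σ) (IStarPrimeRes I Is r) + h (xiPrimeRes ξ ξs σ) (IPrimeRes I Is r) -
      h ξs Is - h ξ I) *
    (I + Is) ^ α * ‖ξ - ξs‖ ^ β * (r * (1 - r)) ^ (δ / 2 - 1)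

/-- The resonant linearized collision operator `L_r`. -/
def Lr (m kB δ n Ttr Tint α β Cr : ℝ) (u : V3) (h : V3 → ℝ → ℝ) (ξ : V3) (I : ℝ) : ℝ :=
  -Cr * ∫ Is in Set.Ici (0 : ℝ), ∫ ξs : V3,
    (∫ σ : Sph, (∫ r in Set.Icc (0 : ℝ) 1,
      LrIntegrand m kB δ n Ttr Tint α β u h ξ I Is ξs σ r) ∂sphMeasure)

/-- The product measure for the full 7-variable integrand of `Q_s`-moments:
variables `(ξ, I, ξ_*, I_*, σ, r, R)`. -/
def stdMeasure : Measure (V3 × ℝ × V3 × ℝ × Sph × ℝ × ℝ) :=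
  (volume : Measure V3).prod
    (((volume : Measure ℝ).restrict (Set.Ici 0)).prod
      ((volume : Measure V3).prod
        (((volume : Measure ℝ).restrict (Set.Ici 0)).prod
          (sphMeasure.prod
            (((volume : Measure ℝ).restrict (Set.Icc 0 1)).prod
              ((volume : Measure ℝ).restrict (Set.Icc 0 1)))))))

/-- The product measure for the full 6-variable integrand of `Q_r`-moments:
variables `(ξ, I, ξ_*, I_*, σ, r)`. -/
def resMeasure : Measure (V3 × ℝ × V3 × ℝ × Sph × ℝ) :=
  (volume : Measure V3).prod
    (((volume : Measure ℝ).restrict (Set.Ici 0)).prod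
      ((volume : Measure V3).prod
        (((volume : Measure ℝ).restrict (Set.Ici 0)).prod
          (sphMeasure.prod ((volume : Measure ℝ).restrict (Set.Icc 0 1))))))

/-- The product measure for the kernel variables `(I_*, ξ_*, σ, r)` of `L_r`. -/
def resKernelMeasure : Measure (ℝ × V3 × Sph × ℝ) :=
  ((volume : Measure ℝ).restrict (Set.Ici 0)).prod
    ((volume : Measure V3).prod (sphMeasure.prod ((volume : Measure ℝ).restrict (Set.Icc 0 1))))

/-- The linearized collision operator `L_θ h = -2 M_s⁻¹ [θ Q_s(M_s, M_s h)
+ (1-θ) Q_r(M_s, M_s h)]`. -/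
def Ltheta (m kB δ n T α β Cr Cs θ : ℝ) (u : V3) (h : V3 → ℝ → ℝ)
    (ξ : V3) (I : ℝ) : ℝ :=
  -2 / Ms m kB δ n T u ξ I *
    (θ * Qs m δ α β Cs (Ms m kB δ n T u)
        (fun x J => Ms m kB δ n T u x J * h x J) ξ I +
      (1 - θ) * Qr δ α β Cr (Ms m kB δ n T u)
        (fun x J => Ms m kB δ n T u x J * h x J) ξ I)

instance : IsFiniteMeasure sphMeasure := by unfold sphMeasure; infer_instance

lemma measurePreserving_neg_sphMeasure :
    MeasurePreserving (fun σ : Sph => -σ) sphMeasure sphMeasure := by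
  refine ⟨by fun_prop, ?_⟩
  ext s hs
  rw [Measure.map_apply (by fun_prop) hs, sphMeasure, Measure.toSphere_apply' _ hs,
    Measure.toSphere_apply' _ ((measurable_neg : Measurable fun σ : Sph => -σ) hs)]
  congr 1
  rw [← Measure.measure_neg]
  congr 1
  ext v
  simp only [Set.mem_neg, Set.mem_smul, Set.mem_image, Set.mem_preimage, Subtype.exists]
  constructor
  · rintro ⟨t, ht, _, ⟨w, hw, hws, rfl⟩, htw⟩
    exact ⟨t, ht, -w, ⟨-w, by simpa using hw, hws, rfl⟩, by simp [htw]⟩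
  · rintro ⟨t, ht, _, ⟨w, hw, hws, rfl⟩, htw⟩
    refine ⟨t, ht, -w, ⟨-w, by simpa using hw, ?_, rfl⟩, by simp [htw]⟩
    convert hws
    ext1
    simp

lemma lintegral_comp_const_mul (f : ℝ → ENNReal) {s : ℝ} (hs : 0 < s) :
    ∫⁻ x, f x = ENNReal.ofReal s * ∫⁻ r, f (s * r) := by
  have h1 := Measure.map_addHaar_smul (volume : Measure ℝ) hs.ne'
  have h2 : ∫⁻ r, f (s * r) = ∫⁻ x, f x ∂(Measure.map (s • ·) volume) := by
    rw [(measurableEmbedding_const_smul₀ hs.ne').lintegral_map]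
    rfl
  rw [h2, h1, lintegral_smul_measure, Module.finrank_self, pow_one, abs_of_pos (inv_pos.2 hs),
    smul_eq_mul, ← mul_assoc, ← ENNReal.ofReal_mul hs.le, mul_inv_cancel₀ hs.ne']
  simp

/-- Change of variables `(x, y) = (r s, (1 - r) s)` on the positive quadrant. -/
lemma lintegral_quadrant {F : ℝ → ℝ → ENNReal} (hF : Measurable (Function.uncurry F)) :
    ∫⁻ x in Set.Ioi (0 : ℝ), ∫⁻ y in Set.Ioi (0 : ℝ), F x y =
      ∫⁻ s in Set.Ioi (0 : ℝ), ∫⁻ r in Set.Ioo (0 : ℝ) 1,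
        ENNReal.ofReal s * F (r * s) ((1 - r) * s) := by
  have hA : MeasurableSet {p : ℝ × ℝ | 0 < p.1 ∧ p.1 < p.2} :=
    (measurableSet_lt measurable_const measurable_fst).inter
      (measurableSet_lt measurable_fst measurable_snd)
  let G : ℝ → ℝ → ENNReal := fun x s =>
    {p : ℝ × ℝ | 0 < p.1 ∧ p.1 < p.2}.indicator (fun p => F p.1 (p.2 - p.1)) (x, s)
  have hG : Measurable (Function.uncurry G) := by
    refine Measurable.indicator ?_ hA
    exact hF.comp (measurable_fst.prodMk (measurable_snd.sub measurable_fst))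
  have h1 : ∫⁻ x in Set.Ioi (0 : ℝ), ∫⁻ y in Set.Ioi (0 : ℝ), F x y = ∫⁻ x, ∫⁻ s, G x s := by
    rw [← lintegral_indicator measurableSet_Ioi]
    refine lintegral_congr fun x => ?_
    by_cases hx : 0 < x
    · rw [Set.indicator_of_mem (Set.mem_Ioi.2 hx), ← lintegral_indicator measurableSet_Ioi,
        ← lintegral_sub_right_eq_self _ x]
      refine lintegral_congr fun s => ?_
      simp only [G, Set.indicator_apply, Set.mem_Ioi, Set.mem_ofPred_eq, hx, true_and, sub_pos]
    · rw [Set.indicator_of_notMem (by simpa using hx)]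
      simp [G, Set.indicator_apply, hx]
  rw [h1, lintegral_lintegral_swap hG.aemeasurable, ← lintegral_indicator measurableSet_Ioi]
  refine lintegral_congr fun s => ?_
  by_cases hs : 0 < s
  · rw [Set.indicator_of_mem (Set.mem_Ioi.2 hs), lintegral_comp_const_mul _ hs,
      lintegral_const_mul _ (by fun_prop), ← lintegral_indicator measurableSet_Ioo]
    congr 1
    refine lintegral_congr fun r => ?_
    have h2 : 0 < s * r ∧ s * r < s ↔ 0 < r ∧ r < 1 := by
      constructor
      · rintro ⟨h, h'⟩
        exact ⟨pos_of_mul_pos_right h hs.le, by nlinarith⟩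
      · rintro ⟨h, h'⟩
        exact ⟨by positivity, by nlinarith⟩
    simp only [G, Set.indicator_apply, Set.mem_ofPred_eq, Set.mem_Ioo, h2]
    congr 2 <;> ring
  · rw [Set.indicator_of_notMem (by simpa using hs)]
    have : ∀ x, ¬ (0 < x ∧ x < s) := fun x hx => hs (hx.1.trans hx.2)
    simp [G, Set.indicator_apply, this]

/-- Integration in polar coordinates. -/
lemma lintegral_polar {f : V3 → ENNReal} (hf : Measurable f) :
    ∫⁻ v, f v = ∫⁻ ρ in Set.Ioi (0 : ℝ), ∫⁻ σ : Sph,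
      ENNReal.ofReal (ρ ^ 2) * f (ρ • (σ : V3)) ∂sphMeasure := by
  have hmp := (volume : Measure V3).measurePreserving_homeomorphUnitSphereProd
  have hsc : MeasurableSet ({0}ᶜ : Set V3) := (measurableSet_singleton _).compl
  have h1 : ∫⁻ v, f v = ∫⁻ x : ({(0 : V3)}ᶜ : Set V3), f x ∂(volume.comap Subtype.val) := by
    rw [lintegral_subtype_comap hsc, restrict_compl_singleton]
  let k : Sph × Set.Ioi (0 : ℝ) → ENNReal := fun p => f (p.2.1 • (p.1 : V3))
  have hk : Measurable k := by
    refine hf.comp ?_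
    fun_prop
  have h2 : ∫⁻ x : ({(0 : V3)}ᶜ : Set V3), f x ∂(volume.comap Subtype.val) =
      ∫⁻ p, k p ∂(sphMeasure.prod (Measure.volumeIoiPow 2)) := by
    have h3 : Module.finrank ℝ V3 - 1 = 2 := by simp
    have h4 := hmp.lintegral_comp hk
    rw [h3] at h4
    rw [sphMeasure, ← h4]
    refine lintegral_congr fun x => ?_
    have hx : ‖(x : V3)‖ ≠ 0 := norm_ne_zero_iff.2 x.2
    simp [k, smul_smul, hx]
  rw [h1, h2, lintegral_prod_symm _ hk.aemeasurable, Measure.volumeIoiPow,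
    lintegral_withDensity_eq_lintegral_mul _ (by fun_prop) hk.lintegral_prod_left',
    ← lintegral_subtype_comap measurableSet_Ioi]
  refine lintegral_congr fun ρ => ?_
  rw [lintegral_const_mul _ (by fun_prop)]
  rfl

/-- Change of variables to the center of mass and half the relative velocity. -/
lemma lintegral_centerOfMass {P : V3 → V3 → ENNReal} (hP : Measurable (Function.uncurry P)) :
    ∫⁻ x, ∫⁻ y, P x y = ∫⁻ w : V3, ∫⁻ v : V3, ENNReal.ofReal 8 * P (w + v) (w - v) := by
  have h1 : ∀ x, ∫⁻ y, P x y = ∫⁻ v : V3, ENNReal.ofReal 8 * P x (x - (2 : ℝ) • v) := by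
    intro x
    have h2 := Measure.map_addHaar_smul (volume : Measure V3) (two_ne_zero (α := ℝ))
    have hm : Measurable fun y => P x (x - y) := by fun_prop
    have h3 : ∫⁻ v : V3, P x (x - (2 : ℝ) • v) =
        ∫⁻ y, P x (x - y) ∂(Measure.map ((2 : ℝ) • ·) (volume : Measure V3)) := by
      rw [lintegral_map hm (by fun_prop)]
    rw [lintegral_const_mul _ (by fun_prop), h3, h2, lintegral_smul_measure,
      lintegral_sub_left_eq_self (fun y => P x y) x, smul_eq_mul, ← mul_assoc,
      ← ENNReal.ofReal_mul (by norm_num)]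
    norm_num
  simp_rw [h1]
  rw [lintegral_lintegral_swap (by fun_prop)]
  have h4 : ∀ v : V3, ∫⁻ x, ENNReal.ofReal 8 * P x (x - (2 : ℝ) • v) =
      ∫⁻ w, ENNReal.ofReal 8 * P (w + v) (w - v) := by
    intro v
    rw [← lintegral_add_right_eq_self _ v]
    refine lintegral_congr fun w => ?_
    congr 2
    rw [two_smul]
    abel
  simp_rw [h4]
  rw [lintegral_lintegral_swap (by fun_prop)]

/-- The two-particle phase space, parametrized by the center-of-mass velocity, half the relative
speed, the total internal energy, the direction of the relative velocity and the fraction of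
internal energy carried by the first particle. -/
lemma lintegral_twoParticle_resonant {F : V3 × ℝ × V3 × ℝ → ENNReal} (hF : Measurable F) :
    ∫⁻ x, ∫⁻ I in Set.Ioi (0 : ℝ), ∫⁻ y, ∫⁻ J in Set.Ioi (0 : ℝ), F (x, I, y, J) =
      ∫⁻ w : V3, ∫⁻ ρ in Set.Ioi (0 : ℝ), ∫⁻ S in Set.Ioi (0 : ℝ),
        ∫⁻ q : Sph × ℝ, ENNReal.ofReal (8 * ρ ^ 2 * S) *
          F (w + ρ • (q.1 : V3), q.2 * S, w - ρ • (q.1 : V3), (1 - q.2) * S)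
          ∂(sphMeasure.prod (volume.restrict (Set.Ioo (0 : ℝ) 1))) := by
  have h1 : ∀ x, ∫⁻ I in Set.Ioi (0 : ℝ), ∫⁻ y, ∫⁻ J in Set.Ioi (0 : ℝ), F (x, I, y, J) =
      ∫⁻ y, ∫⁻ S in Set.Ioi (0 : ℝ), ∫⁻ r in Set.Ioo (0 : ℝ) 1,
        ENNReal.ofReal S * F (x, r * S, y, (1 - r) * S) := by
    intro x
    rw [lintegral_lintegral_swap]
    · refine lintegral_congr fun y => ?_
      exact lintegral_quadrant (F := fun I J => F (x, I, y, J)) (by fun_prop)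
    · refine Measurable.aemeasurable ?_
      exact Measurable.lintegral_prod_right' (f := fun p : (ℝ × V3) × ℝ =>
        F (x, p.1.1, p.1.2, p.2)) (by fun_prop)
  simp_rw [h1]
  have hm : Measurable fun p : ((V3 × V3) × ℝ) × ℝ =>
      ENNReal.ofReal p.1.2 * F (p.1.1.1, p.2 * p.1.2, p.1.1.2, (1 - p.2) * p.1.2) := by fun_prop
  have hm2 : Measurable fun p : V3 × V3 => ∫⁻ S in Set.Ioi (0 : ℝ), ∫⁻ r in Set.Ioo (0 : ℝ) 1,
      ENNReal.ofReal S * F (p.1, r * S, p.2, (1 - r) * S) :=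
    hm.lintegral_prod_right'.lintegral_prod_right'
  rw [lintegral_centerOfMass (P := fun x y => ∫⁻ S in Set.Ioi (0 : ℝ), ∫⁻ r in Set.Ioo (0 : ℝ) 1,
      ENNReal.ofReal S * F (x, r * S, y, (1 - r) * S)) hm2]
  refine lintegral_congr fun w => ?_
  have hm3 : Measurable fun v : V3 => (w + v, w - v) := by fun_prop
  refine (lintegral_polar ((hm2.comp hm3).const_mul (ENNReal.ofReal 8))).trans ?_
  simp only [Function.comp_apply]
  refine setLIntegral_congr_fun measurableSet_Ioi fun ρ hρ => ?_
  have hm4 : Measurable fun p : (ℝ × Sph) × ℝ => ENNReal.ofReal (8 * ρ ^ 2 * p.1.1) *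
      F (w + ρ • (p.1.2 : V3), p.2 * p.1.1, w - ρ • (p.1.2 : V3), (1 - p.2) * p.1.1) := by
    fun_prop
  have hm5 : ∀ S : ℝ, Measurable fun q : Sph × ℝ => ENNReal.ofReal (8 * ρ ^ 2 * S) *
      F (w + ρ • (q.1 : V3), q.2 * S, w - ρ • (q.1 : V3), (1 - q.2) * S) := by
    fun_prop
  simp_rw [lintegral_prod _ (hm5 _).aemeasurable]
  rw [lintegral_lintegral_swap hm4.lintegral_prod_right'.aemeasurable]
  refine lintegral_congr fun σ => ?_
  have hm6 : Measurable fun p : ℝ × ℝ =>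
      ENNReal.ofReal p.1 * F (w + ρ • (σ : V3), p.2 * p.1, w - ρ • (σ : V3), (1 - p.2) * p.1) := by
    fun_prop
  have hm7 : Measurable fun S : ℝ => ∫⁻ r in Set.Ioo (0 : ℝ) 1,
      ENNReal.ofReal S * F (w + ρ • (σ : V3), r * S, w - ρ • (σ : V3), (1 - r) * S) :=
    hm6.lintegral_prod_right'
  rw [← mul_assoc, ← lintegral_const_mul _ hm7]
  refine lintegral_congr fun S => ?_
  rw [← lintegral_const_mul _ (by fun_prop)]
  refine lintegral_congr fun r => ?_
  rw [← mul_assoc, ← ENNReal.ofReal_mul (by positivity), ← ENNReal.ofReal_mul (by positivity),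
    mul_comm (ρ ^ 2) 8]

/-- Integration over a half-line of speeds in terms of the kinetic energy `m ρ²`. -/
lemma lintegral_kinetic {m : ℝ} (hm : 0 < m) (f : ℝ → ENNReal) :
    ∫⁻ ρ in Set.Ioi (0 : ℝ), ENNReal.ofReal (8 * ρ ^ 2) * f ρ =
      ∫⁻ K in Set.Ioi (0 : ℝ), ENNReal.ofReal (4 / m * √(K / m)) * f (√(K / m)) := by
  have him : (fun ρ : ℝ => m * ρ ^ 2) '' Set.Ioi 0 = Set.Ioi 0 := by
    ext K
    simp only [Set.mem_image, Set.mem_Ioi]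
    constructor
    · rintro ⟨ρ, hρ, rfl⟩
      positivity
    · intro hK
      refine ⟨√(K / m), by positivity, ?_⟩
      rw [Real.sq_sqrt (by positivity)]
      field_simp
  have hd : ∀ ρ ∈ Set.Ioi (0 : ℝ),
      HasDerivWithinAt (fun ρ : ℝ => m * ρ ^ 2) (m * (2 * ρ)) (Set.Ioi 0) ρ := by
    intro ρ _
    have := ((hasDerivAt_pow 2 ρ).const_mul m).hasDerivWithinAt (s := Set.Ioi 0)
    simpa using this
  have hinj : Set.InjOn (fun ρ : ℝ => m * ρ ^ 2) (Set.Ioi 0) := by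
    intro a ha b hb hab
    have : a ^ 2 = b ^ 2 := mul_left_cancel₀ hm.ne' hab
    exact (pow_left_inj₀ (le_of_lt ha) (le_of_lt hb) two_ne_zero).1 this
  have key := lintegral_image_eq_lintegral_abs_deriv_mul measurableSet_Ioi hd hinj
    (fun K => ENNReal.ofReal (4 / m * √(K / m)) * f (√(K / m)))
  rw [him] at key
  rw [key]
  refine setLIntegral_congr_fun measurableSet_Ioi fun ρ hρ => ?_
  have hρ' : 0 < ρ := hρ
  have h1 : √(m * ρ ^ 2 / m) = ρ := by
    rw [mul_div_cancel_left₀ _ hm.ne', Real.sqrt_sq hρ'.le]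
  simp only [h1]
  rw [← mul_assoc, ← ENNReal.ofReal_mul (by positivity), abs_of_pos (by positivity)]
  congr 2
  field_simp
  ring

/-- The two-particle phase space, parametrized by the center-of-mass velocity, the total energy in
the center-of-mass frame, the direction of the relative velocity, the fraction of internal energy
carried by the first particle and the fraction of kinetic energy. -/
lemma lintegral_twoParticle_standard {m : ℝ} (hm : 0 < m)
    {F : V3 × ℝ × V3 × ℝ → ENNReal} (hF : Measurable F) :
    ∫⁻ x, ∫⁻ I in Set.Ioi (0 : ℝ), ∫⁻ y, ∫⁻ J in Set.Ioi (0 : ℝ), F (x, I, y, J) =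
      ∫⁻ w : V3, ∫⁻ E in Set.Ioi (0 : ℝ),
        ∫⁻ q : Sph × ℝ × ℝ,
          ENNReal.ofReal (4 / m * √(q.2.2 * E / m) * ((1 - q.2.2) * E) * E) *
          F (w + √(q.2.2 * E / m) • (q.1 : V3), q.2.1 * (1 - q.2.2) * E,
            w - √(q.2.2 * E / m) • (q.1 : V3), (1 - q.2.1) * (1 - q.2.2) * E)
          ∂(sphMeasure.prod ((volume.restrict (Set.Ioo (0 : ℝ) 1)).prod
            (volume.restrict (Set.Ioo (0 : ℝ) 1)))) := by
  rw [lintegral_twoParticle_resonant hF]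
  refine lintegral_congr fun w => ?_
  let N : ℝ → ℝ → ENNReal := fun ρ S => ∫⁻ q : Sph × ℝ, ENNReal.ofReal S *
          F (w + ρ • (q.1 : V3), q.2 * S, w - ρ • (q.1 : V3), (1 - q.2) * S)
          ∂(sphMeasure.prod (volume.restrict (Set.Ioo (0 : ℝ) 1)))
  have hN : Measurable (Function.uncurry N) := by
    refine Measurable.lintegral_prod_right' (f := fun p : (ℝ × ℝ) × (Sph × ℝ) =>
      ENNReal.ofReal p.1.2 * F (w + p.1.1 • (p.2.1 : V3), p.2.2 * p.1.2,
        w - p.1.1 • (p.2.1 : V3), (1 - p.2.2) * p.1.2)) ?_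
    fun_prop
  have h1 : ∀ ρ ∈ Set.Ioi (0 : ℝ), ∫⁻ S in Set.Ioi (0 : ℝ),
        ∫⁻ q : Sph × ℝ, ENNReal.ofReal (8 * ρ ^ 2 * S) *
          F (w + ρ • (q.1 : V3), q.2 * S, w - ρ • (q.1 : V3), (1 - q.2) * S)
          ∂(sphMeasure.prod (volume.restrict (Set.Ioo (0 : ℝ) 1))) =
      ENNReal.ofReal (8 * ρ ^ 2) * ∫⁻ S in Set.Ioi (0 : ℝ), N ρ S := by
    intro ρ _
    rw [← lintegral_const_mul _ (by fun_prop)]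
    refine lintegral_congr fun S => ?_
    rw [← lintegral_const_mul _ (by fun_prop)]
    refine lintegral_congr fun q => ?_
    rw [← mul_assoc, ENNReal.ofReal_mul (by positivity)]
  rw [setLIntegral_congr_fun measurableSet_Ioi h1,
    lintegral_kinetic hm (fun ρ => ∫⁻ S in Set.Ioi (0 : ℝ), N ρ S)]
  have h2 : ∀ K, ENNReal.ofReal (4 / m * √(K / m)) * ∫⁻ S in Set.Ioi (0 : ℝ), N (√(K / m)) S =
      ∫⁻ S in Set.Ioi (0 : ℝ), ENNReal.ofReal (4 / m * √(K / m)) * N (√(K / m)) S := by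
    intro K
    rw [lintegral_const_mul _ (by fun_prop)]
  simp_rw [h2]
  rw [lintegral_quadrant (F := fun K S => ENNReal.ofReal (4 / m * √(K / m)) * N (√(K / m)) S)
    (by fun_prop)]
  refine setLIntegral_congr_fun measurableSet_Ioi fun E hE => ?_
  have hE' : 0 < E := hE
  have hm7 : Measurable fun q : Sph × ℝ × ℝ =>
      ENNReal.ofReal (4 / m * √(q.2.2 * E / m) * ((1 - q.2.2) * E) * E) *
          F (w + √(q.2.2 * E / m) • (q.1 : V3), q.2.1 * (1 - q.2.2) * E,
            w - √(q.2.2 * E / m) • (q.1 : V3), (1 - q.2.1) * (1 - q.2.2) * E) := by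
    fun_prop
  rw [← (measurePreserving_prodAssoc _ _ _).lintegral_comp hm7]
  rw [lintegral_prod_symm]
  swap
  · exact (hm7.comp MeasurableEquiv.prodAssoc.measurable).aemeasurable
  refine setLIntegral_congr_fun measurableSet_Ioo fun R hR => ?_
  have hR0 : 0 < R := hR.1
  have hR1 : 0 < 1 - R := sub_pos.2 hR.2
  simp only [N]
  rw [← lintegral_const_mul _ (by fun_prop), ← lintegral_const_mul _ (by fun_prop)]
  refine lintegral_congr fun q => ?_
  simp only [MeasurableEquiv.prodAssoc, MeasurableEquiv.coe_mk, Equiv.prodAssoc_apply]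
  rw [← mul_assoc, ← mul_assoc, ← ENNReal.ofReal_mul (by positivity),
    ← ENNReal.ofReal_mul (by positivity)]
  congr 2
  · ring
  · simp only [mul_assoc]

/-- The change of variables from parameters `(x, q)`, with density `J`, to pairs of particles
`(A (x, q), B (x, q))`, extended by a spectator variable. -/
lemma map_twoParticle_spectator {X Y : Type*} [MeasurableSpace X] [MeasurableSpace Y]
    (η : Measure X) (ν : Measure Y) [SFinite η] [SFinite ν]
    {A B : X × Y → V3 × ℝ} (hA : Measurable A) (hB : Measurable B)
    {J : X × Y → ℝ} (hJ : Measurable J)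
    (H : ∀ F : V3 × ℝ × V3 × ℝ → ENNReal, Measurable F →
      ∫⁻ x, ∫⁻ I in Set.Ioi (0 : ℝ), ∫⁻ y, ∫⁻ K in Set.Ioi (0 : ℝ), F (x, I, y, K) =
        ∫⁻ x, ∫⁻ q, ENNReal.ofReal (J (x, q)) *
          F ((A (x, q)).1, (A (x, q)).2, (B (x, q)).1, (B (x, q)).2) ∂ν ∂η) :
    Measure.map (fun p : X × (Y × Y) => ((A (p.1, p.2.1)).1, (A (p.1, p.2.1)).2,
        (B (p.1, p.2.1)).1, (B (p.1, p.2.1)).2, p.2.2))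
      ((η.prod (ν.prod ν)).withDensity fun p => ENNReal.ofReal (J (p.1, p.2.1))) =
    (volume : Measure V3).prod ((volume.restrict (Set.Ioi (0 : ℝ))).prod
      ((volume : Measure V3).prod ((volume.restrict (Set.Ioi (0 : ℝ))).prod ν))) := by
  refine Measure.ext_of_lintegral _ fun f hf => ?_
  have hm1 : Measurable fun p : ((V3 × ℝ) × V3) × (ℝ × Y) =>
      f (p.1.1.1, p.1.1.2, p.1.2, p.2) := by fun_prop
  have hm2 : Measurable fun p : (V3 × ℝ) × (V3 × ℝ × Y) => f (p.1.1, p.1.2, p.2) := by fun_prop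
  have hm3 : Measurable fun p : (V3 × ℝ × V3 × ℝ) × Y =>
      f (p.1.1, p.1.2.1, p.1.2.2.1, p.1.2.2.2, p.2) := by fun_prop
  have hm4 : Measurable fun p : X × (Y × Y) => f ((A (p.1, p.2.1)).1, (A (p.1, p.2.1)).2,
        (B (p.1, p.2.1)).1, (B (p.1, p.2.1)).2, p.2.2) := by fun_prop
  rw [lintegral_map hf (by fun_prop),
    lintegral_withDensity_eq_lintegral_mul _ (by fun_prop) hm4]
  have hR : ∀ x I y, ∫⁻ p, f (x, I, y, p) ∂((volume.restrict (Set.Ioi (0 : ℝ))).prod ν) =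
      ∫⁻ K in Set.Ioi (0 : ℝ), ∫⁻ q, f (x, I, y, K, q) ∂ν := fun x I y =>
    lintegral_prod _ (by fun_prop)
  have hR2 : ∀ x I, ∫⁻ p, f (x, I, p)
        ∂((volume : Measure V3).prod ((volume.restrict (Set.Ioi (0 : ℝ))).prod ν)) =
      ∫⁻ y, ∫⁻ K in Set.Ioi (0 : ℝ), ∫⁻ q, f (x, I, y, K, q) ∂ν := fun x I => by
    rw [lintegral_prod _ (by fun_prop)]
    simp_rw [hR]
  have hR3 : ∀ x, ∫⁻ p, f (x, p) ∂((volume.restrict (Set.Ioi (0 : ℝ))).prod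
        ((volume : Measure V3).prod ((volume.restrict (Set.Ioi (0 : ℝ))).prod ν))) =
      ∫⁻ I in Set.Ioi (0 : ℝ), ∫⁻ y, ∫⁻ K in Set.Ioi (0 : ℝ), ∫⁻ q, f (x, I, y, K, q) ∂ν :=
    fun x => by
      rw [lintegral_prod _ (by fun_prop)]
      simp_rw [hR2]
  rw [lintegral_prod _ hf.aemeasurable]
  simp_rw [hR3]
  rw [H (fun z => ∫⁻ q, f (z.1, z.2.1, z.2.2.1, z.2.2.2, q) ∂ν) hm3.lintegral_prod_right',
    lintegral_prod _ (by fun_prop)]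
  refine lintegral_congr fun x => ?_
  rw [lintegral_prod _ (by fun_prop)]
  refine lintegral_congr fun q => ?_
  rw [← lintegral_const_mul _ (by fun_prop)]
  rfl

/-- The weak form of a linearized collision operator in symmetric parameters: exchanging the
particles (`j`) and exchanging the pre- and post-collisional states each leave the kernel `k`
invariant. -/
lemma integral_symmetrize {X Y : Type*} [MeasurableSpace X] [MeasurableSpace Y]
    {η : Measure X} {ν : Measure Y} [SFinite η] [SFinite ν]
    {j : Y → Y} (hj : MeasurePreserving j ν ν)
    {k : X → Y → Y → ℝ} (hk : ∀ x q q', k x q q' = k x q' q)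
    (hkj : ∀ x q q', k x (j q) q' = k x q q')
    {a b : X → Y → ℝ} {a' b' : X → Y → ℝ}
    (hab : ∀ x q, a x (j q) = b x q) (hba : ∀ x q, b x (j q) = a x q)
    (hab' : ∀ x q, a' x (j q) = b' x q)
    (hint : Integrable (fun p : X × (Y × Y) => k p.1 p.2.1 p.2.2 *
      (a p.1 p.2.2 + b p.1 p.2.2 - a p.1 p.2.1 - b p.1 p.2.1) * a' p.1 p.2.1)
      (η.prod (ν.prod ν))) :
    4 * ∫ p : X × (Y × Y), k p.1 p.2.1 p.2.2 *
      (a p.1 p.2.2 + b p.1 p.2.2 - a p.1 p.2.1 - b p.1 p.2.1) * a' p.1 p.2.1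
      ∂(η.prod (ν.prod ν)) =
    -∫ p : X × (Y × Y), k p.1 p.2.1 p.2.2 *
      (a p.1 p.2.2 + b p.1 p.2.2 - a p.1 p.2.1 - b p.1 p.2.1) *
      (a' p.1 p.2.2 + b' p.1 p.2.2 - a' p.1 p.2.1 - b' p.1 p.2.1) ∂(η.prod (ν.prod ν)) := by
  set f : X × (Y × Y) → ℝ := fun p => k p.1 p.2.1 p.2.2 *
      (a p.1 p.2.2 + b p.1 p.2.2 - a p.1 p.2.1 - b p.1 p.2.1) * a' p.1 p.2.1 with hf
  have hS : MeasurePreserving (Prod.map (id : X → X) (Prod.map j (id : Y → Y)))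
      (η.prod (ν.prod ν)) (η.prod (ν.prod ν)) :=
    (MeasurePreserving.id η).prod (hj.prod (MeasurePreserving.id ν))
  have hT : MeasurePreserving (Prod.map (id : X → X) (Prod.swap : Y × Y → Y × Y))
      (η.prod (ν.prod ν)) (η.prod (ν.prod ν)) :=
    (MeasurePreserving.id η).prod Measure.measurePreserving_swap
  have comp : ∀ {φ : X × (Y × Y) → X × (Y × Y)} (_ : MeasurePreserving φ
      (η.prod (ν.prod ν)) (η.prod (ν.prod ν))) {g : X × (Y × Y) → ℝ}
      (_ : Integrable g (η.prod (ν.prod ν))), Integrable (fun p => g (φ p)) (η.prod (ν.prod ν)) ∧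
        ∫ p, g (φ p) ∂(η.prod (ν.prod ν)) = ∫ p, g p ∂(η.prod (ν.prod ν)) := by
    intro φ hφ g hg
    refine ⟨hφ.integrable_comp_of_integrable hg, ?_⟩
    rw [← integral_map hφ.aemeasurable (by rw [hφ.map_eq]; exact hg.aestronglyMeasurable),
      hφ.map_eq]
  obtain ⟨i1, e1⟩ := comp hS hint
  have hint2 := hint.add i1
  obtain ⟨i2, e2⟩ := comp hT hint2
  have e3 : ∫ p, (f p + f (Prod.map (id : X → X) (Prod.map j (id : Y → Y)) p))
      ∂(η.prod (ν.prod ν)) = 2 * ∫ p, f p ∂(η.prod (ν.prod ν)) := by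
    rw [integral_add hint i1, e1, two_mul]
  have e4 : ∫ p, ((f + fun p => f (Prod.map (id : X → X) (Prod.map j (id : Y → Y)) p)) p +
      (f + fun p => f (Prod.map (id : X → X) (Prod.map j (id : Y → Y)) p))
        (Prod.map (id : X → X) (Prod.swap : Y × Y → Y × Y) p)) ∂(η.prod (ν.prod ν)) =
      4 * ∫ p, f p ∂(η.prod (ν.prod ν)) := by
    rw [integral_add hint2 i2, e2]
    simp only [Pi.add_apply]
    rw [e3]
    ring
  rw [← e4, ← integral_neg]
  refine integral_congr_ae (Filter.Eventually.of_forall fun p => ?_)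
  obtain ⟨x, q, q'⟩ := p
  simp only [hf, Pi.add_apply, Prod.map_apply, id, Prod.swap_prod_mk, hkj, hab, hba, hab',
    hk x q' q]
  ring

/-- The weak form of a linearized collision operator, after the change of variables to
symmetric parameters. -/
lemma integral_collision_form {X Y : Type*} [MeasurableSpace X] [MeasurableSpace Y]
    {η : Measure X} {ν : Measure Y} [SFinite η] [SFinite ν]
    {A B : X × Y → V3 × ℝ} (hA : Measurable A) (hB : Measurable B)
    {J : X × Y → ℝ} (hJ : Measurable J)
    (H : ∀ F : V3 × ℝ × V3 × ℝ → ENNReal, Measurable F →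
      ∫⁻ x, ∫⁻ I in Set.Ioi (0 : ℝ), ∫⁻ y, ∫⁻ K in Set.Ioi (0 : ℝ), F (x, I, y, K) =
        ∫⁻ x, ∫⁻ q, ENNReal.ofReal (J (x, q)) *
          F ((A (x, q)).1, (A (x, q)).2, (B (x, q)).1, (B (x, q)).2) ∂ν ∂η)
    {j : Y → Y} (hj : MeasurePreserving j ν ν)
    (hAB : ∀ x q, A (x, j q) = B (x, q)) (hBA : ∀ x q, B (x, j q) = A (x, q))
    {k : X → Y → Y → ℝ} (hk : ∀ x q q', k x q q' = k x q' q)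
    (hkj : ∀ x q q', k x (j q) q' = k x q q')
    {h g : V3 → ℝ → ℝ} {f : V3 × ℝ × V3 × ℝ × Y → ℝ}
    (hf : ∀ᵐ p ∂(η.prod (ν.prod ν)), max (J (p.1, p.2.1)) 0 *
      f ((A (p.1, p.2.1)).1, (A (p.1, p.2.1)).2,
        (B (p.1, p.2.1)).1, (B (p.1, p.2.1)).2, p.2.2) = k p.1 p.2.1 p.2.2 *
          (h (A (p.1, p.2.2)).1 (A (p.1, p.2.2)).2 + h (B (p.1, p.2.2)).1 (B (p.1, p.2.2)).2 -
            h (A (p.1, p.2.1)).1 (A (p.1, p.2.1)).2 - h (B (p.1, p.2.1)).1 (B (p.1, p.2.1)).2))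
    (hint : Integrable (fun p => f p * g p.1 p.2.1)
      ((volume : Measure V3).prod ((volume.restrict (Set.Ioi (0 : ℝ))).prod
      ((volume : Measure V3).prod ((volume.restrict (Set.Ioi (0 : ℝ))).prod ν))))) :
    4 * ∫ p, f p * g p.1 p.2.1
      ∂((volume : Measure V3).prod ((volume.restrict (Set.Ioi (0 : ℝ))).prod
      ((volume : Measure V3).prod ((volume.restrict (Set.Ioi (0 : ℝ))).prod ν)))) =
    -∫ p : X × (Y × Y), k p.1 p.2.1 p.2.2 *
      (h (A (p.1, p.2.2)).1 (A (p.1, p.2.2)).2 + h (B (p.1, p.2.2)).1 (B (p.1, p.2.2)).2 -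
        h (A (p.1, p.2.1)).1 (A (p.1, p.2.1)).2 - h (B (p.1, p.2.1)).1 (B (p.1, p.2.1)).2) *
      (g (A (p.1, p.2.2)).1 (A (p.1, p.2.2)).2 + g (B (p.1, p.2.2)).1 (B (p.1, p.2.2)).2 -
        g (A (p.1, p.2.1)).1 (A (p.1, p.2.1)).2 - g (B (p.1, p.2.1)).1 (B (p.1, p.2.1)).2)
      ∂(η.prod (ν.prod ν)) := by
  rw [← map_twoParticle_spectator η ν hA hB hJ H] at hint ⊢
  have hΦ : Measurable fun p : X × (Y × Y) => ((A (p.1, p.2.1)).1, (A (p.1, p.2.1)).2,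
        (B (p.1, p.2.1)).1, (B (p.1, p.2.1)).2, p.2.2) := by fun_prop
  have hJ' : Measurable fun p : X × (Y × Y) => (J (p.1, p.2.1)).toNNReal := by fun_prop
  rw [integral_map hΦ.aemeasurable hint.aestronglyMeasurable]
  rw [integrable_map_measure hint.aestronglyMeasurable hΦ.aemeasurable] at hint
  simp only [ENNReal.ofReal] at hint ⊢
  rw [integrable_withDensity_iff_integrable_smul hJ'] at hint
  rw [integral_withDensity_eq_integral_smul hJ']
  have hcongr : (fun p : X × (Y × Y) => (J (p.1, p.2.1)).toNNReal •
      (f ((A (p.1, p.2.1)).1, (A (p.1, p.2.1)).2, (B (p.1, p.2.1)).1, (B (p.1, p.2.1)).2, p.2.2) *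
        g (A (p.1, p.2.1)).1 (A (p.1, p.2.1)).2)) =ᵐ[η.prod (ν.prod ν)]
      fun p => k p.1 p.2.1 p.2.2 *
          (h (A (p.1, p.2.2)).1 (A (p.1, p.2.2)).2 + h (B (p.1, p.2.2)).1 (B (p.1, p.2.2)).2 -
            h (A (p.1, p.2.1)).1 (A (p.1, p.2.1)).2 - h (B (p.1, p.2.1)).1 (B (p.1, p.2.1)).2) *
          g (A (p.1, p.2.1)).1 (A (p.1, p.2.1)).2 := by
    filter_upwards [hf] with p hp
    rw [NNReal.smul_def, Real.coe_toNNReal', smul_eq_mul, ← mul_assoc, hp]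
  rw [integral_congr_ae hcongr]
  refine integral_symmetrize (a := fun x q => h (A (x, q)).1 (A (x, q)).2)
    (b := fun x q => h (B (x, q)).1 (B (x, q)).2) (a' := fun x q => g (A (x, q)).1 (A (x, q)).2)
    (b' := fun x q => g (B (x, q)).1 (B (x, q)).2) hj hk hkj ?_ ?_ ?_ ?_
  · intro x q
    simp only [hAB]
  · intro x q
    simp only [hBA]
  · intro x q
    simp only [hAB]
  · exact hint.congr hcongr

/-- Reordering of the variables of a collision integral: the post-integration over the partner
`(y, K)` is carried out in the order `K`, `y`. -/
lemma integral_partner_reorder {Y : Type*} [MeasurableSpace Y]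
    (τ : Measure ℝ) (ν : Measure Y) [SFinite τ] [SFinite ν]
    {f : V3 × ℝ × V3 × ℝ × Y → ℝ}
    (hf : Integrable f ((volume : Measure V3).prod (τ.prod ((volume : Measure V3).prod
      (τ.prod ν))))) :
    (∀ᵐ p ∂((volume : Measure V3).prod τ), Integrable (fun y : ℝ × V3 × Y =>
      f (p.1, p.2, y.2.1, y.1, y.2.2)) (τ.prod ((volume : Measure V3).prod ν))) ∧
    Integrable (fun p : V3 × ℝ => ∫ y : ℝ × V3 × Y, f (p.1, p.2, y.2.1, y.1, y.2.2)
      ∂(τ.prod ((volume : Measure V3).prod ν))) ((volume : Measure V3).prod τ) ∧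
    ∫ p : V3 × ℝ, ∫ y : ℝ × V3 × Y, f (p.1, p.2, y.2.1, y.1, y.2.2)
      ∂(τ.prod ((volume : Measure V3).prod ν)) ∂((volume : Measure V3).prod τ) =
    ∫ p, f p ∂((volume : Measure V3).prod (τ.prod ((volume : Measure V3).prod (τ.prod ν)))) := by
  have h1 : MeasurePreserving (fun p : ℝ × V3 × Y => (p.2.1, p.1, p.2.2))
      (τ.prod ((volume : Measure V3).prod ν)) ((volume : Measure V3).prod (τ.prod ν)) :=
    (measurePreserving_prodAssoc _ _ _).comp
      (((Measure.measurePreserving_swap (μ := τ) (ν := (volume : Measure V3))).prod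
        (MeasurePreserving.id ν)).comp (measurePreserving_prodAssoc _ _ _).symm)
  have h2 : MeasurePreserving
      (fun p : (V3 × ℝ) × (ℝ × V3 × Y) => (p.1.1, p.1.2, p.2.2.1, p.2.1, p.2.2.2))
      (((volume : Measure V3).prod τ).prod (τ.prod ((volume : Measure V3).prod ν)))
      ((volume : Measure V3).prod (τ.prod ((volume : Measure V3).prod (τ.prod ν)))) :=
    (measurePreserving_prodAssoc _ _ _).comp ((MeasurePreserving.id _).prod h1)
  have h3 := h2.integrable_comp_of_integrable hf
  refine ⟨h3.prod_right_ae, h3.integral_prod_left, ?_⟩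
  refine (integral_prod _ h3).symm.trans ?_
  rw [← h2.map_eq] at hf
  conv_rhs => rw [← h2.map_eq]
  rw [integral_map h2.aemeasurable hf.aestronglyMeasurable]
  rfl

lemma integral_prod_four {α β γ ε : Type*} [MeasurableSpace α] [MeasurableSpace β]
    [MeasurableSpace γ] [MeasurableSpace ε] {a : Measure α} {b : Measure β} {c : Measure γ}
    {e : Measure ε} [SFinite a] [SFinite b] [SFinite c] [SFinite e] {f : α × β × γ × ε → ℝ}
    (hf : Integrable f (a.prod (b.prod (c.prod e)))) :
    ∫ p, f p ∂(a.prod (b.prod (c.prod e))) =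
      ∫ x, ∫ y, ∫ z, ∫ w, f (x, y, z, w) ∂e ∂c ∂b ∂a := by
  rw [integral_prod _ hf]
  refine integral_congr_ae ?_
  filter_upwards [hf.prod_right_ae] with x hx
  rw [integral_prod _ hx]
  refine integral_congr_ae ?_
  filter_upwards [hx.prod_right_ae] with y hy
  rw [integral_prod _ hy]

lemma integral_prod_five {α β γ ε ζ : Type*} [MeasurableSpace α] [MeasurableSpace β]
    [MeasurableSpace γ] [MeasurableSpace ε] [MeasurableSpace ζ] {a : Measure α} {b : Measure β}
    {c : Measure γ} {e : Measure ε} {z : Measure ζ} [SFinite a] [SFinite b] [SFinite c] [SFinite e]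
    [SFinite z] {f : α × β × γ × ε × ζ → ℝ}
    (hf : Integrable f (a.prod (b.prod (c.prod (e.prod z))))) :
    ∫ p, f p ∂(a.prod (b.prod (c.prod (e.prod z)))) =
      ∫ x, ∫ y, ∫ u, ∫ v, ∫ w, f (x, y, u, v, w) ∂z ∂e ∂c ∂b ∂a := by
  rw [integral_prod _ hf]
  refine integral_congr_ae ?_
  filter_upwards [hf.prod_right_ae] with x hx
  exact integral_prod_four hx

lemma integral_Qs_mul {m δ α β Cs : ℝ} {f F g : V3 → ℝ → ℝ}
    (hf : Integrable (fun p : V3 × ℝ × V3 × ℝ × Sph × ℝ × ℝ =>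
      stdIntegrand m δ α β Cs f F p.1 p.2.1 p.2.2.1 p.2.2.2.1 p.2.2.2.2.1 p.2.2.2.2.2.1
        p.2.2.2.2.2.2 * g p.1 p.2.1) stdMeasure) :
    Integrable (fun p : V3 × ℝ => Qs m δ α β Cs f F p.1 p.2 * g p.1 p.2) phaseMeasure ∧
    ∫ p : V3 × ℝ, Qs m δ α β Cs f F p.1 p.2 * g p.1 p.2 ∂phaseMeasure =
      (1 / 2) * ∫ p : V3 × ℝ × V3 × ℝ × Sph × ℝ × ℝ,
        stdIntegrand m δ α β Cs f F p.1 p.2.1 p.2.2.1 p.2.2.2.1 p.2.2.2.2.1 p.2.2.2.2.2.1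
          p.2.2.2.2.2.2 * g p.1 p.2.1 ∂stdMeasure := by
  obtain ⟨h1, h2, h2'⟩ := integral_partner_reorder _ _ hf
  have h3 := h2.const_mul (1 / 2)
  have h4 : ∀ᵐ p ∂phaseMeasure, (1 / 2) * ∫ y : ℝ × V3 × Sph × ℝ × ℝ,
      stdIntegrand m δ α β Cs f F p.1 p.2 y.2.1 y.1 y.2.2.1 y.2.2.2.1 y.2.2.2.2 * g p.1 p.2
        ∂((volume.restrict (Set.Ici (0 : ℝ))).prod ((volume : Measure V3).prod
          (sphMeasure.prod ((volume.restrict (Set.Icc (0 : ℝ) 1)).prod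
            (volume.restrict (Set.Icc (0 : ℝ) 1)))))) =
      Qs m δ α β Cs f F p.1 p.2 * g p.1 p.2 := by
    filter_upwards [h1] with p hp
    rw [integral_prod_five hp]
    simp only [integral_mul_const, Qs]
    ring
  refine ⟨h3.congr h4, ?_⟩
  rw [stdMeasure, ← h2', ← integral_const_mul]
  exact (integral_congr_ae h4).symm

lemma integral_Qr_mul {δ α β Cr : ℝ} {f F g : V3 → ℝ → ℝ}
    (hf : Integrable (fun p : V3 × ℝ × V3 × ℝ × Sph × ℝ =>
      resIntegrand δ α β Cr f F p.1 p.2.1 p.2.2.1 p.2.2.2.1 p.2.2.2.2.1 p.2.2.2.2.2 *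
        g p.1 p.2.1) resMeasure) :
    Integrable (fun p : V3 × ℝ => Qr δ α β Cr f F p.1 p.2 * g p.1 p.2) phaseMeasure ∧
    ∫ p : V3 × ℝ, Qr δ α β Cr f F p.1 p.2 * g p.1 p.2 ∂phaseMeasure =
      (1 / 2) * ∫ p : V3 × ℝ × V3 × ℝ × Sph × ℝ,
        resIntegrand δ α β Cr f F p.1 p.2.1 p.2.2.1 p.2.2.2.1 p.2.2.2.2.1 p.2.2.2.2.2 *
          g p.1 p.2.1 ∂resMeasure := by
  obtain ⟨h1, h2, h2'⟩ := integral_partner_reorder _ _ hf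
  have h3 := h2.const_mul (1 / 2)
  have h4 : ∀ᵐ p ∂phaseMeasure, (1 / 2) * ∫ y : ℝ × V3 × Sph × ℝ,
      resIntegrand δ α β Cr f F p.1 p.2 y.2.1 y.1 y.2.2.1 y.2.2.2 * g p.1 p.2
        ∂((volume.restrict (Set.Ici (0 : ℝ))).prod ((volume : Measure V3).prod
          (sphMeasure.prod (volume.restrict (Set.Icc (0 : ℝ) 1))))) =
      Qr δ α β Cr f F p.1 p.2 * g p.1 p.2 := by
    filter_upwards [h1] with p hp
    rw [integral_prod_four hp]
    simp only [integral_mul_const, Qr]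
    ring
  refine ⟨h3.congr h4, ?_⟩
  rw [resMeasure, ← h2', ← integral_const_mul]
  exact (integral_congr_ae h4).symm

/-- The factor of `M_s(ξ, I) M_s(ξ_*, I_*)` other than the powers of the internal energies, in terms
of the mean velocity `w` and of the energy `e` in the center-of-mass frame. -/
def pairMaxwellian (m kB δ n T : ℝ) (u w : V3) (e : ℝ) : ℝ :=
  (n / ((2 * π * kB * T / m) ^ ((3 : ℝ) / 2) * (kB * T) ^ (δ / 2) * Real.Gamma (δ / 2))) ^ 2 *
    Real.exp (-(2 * m * ‖w - u‖ ^ 2 + 2 * e) / (2 * kB * T))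

lemma pairMaxwellian_nonneg (m kB δ n T : ℝ) (u w : V3) (e : ℝ) :
    0 ≤ pairMaxwellian m kB δ n T u w e := by
  unfold pairMaxwellian
  positivity

lemma Ms_mul_Ms (m kB δ n T : ℝ) (u w v : V3) {I J : ℝ} (hI : 0 < I) (hJ : 0 < J) :
    Ms m kB δ n T u (w + v) I * Ms m kB δ n T u (w - v) J =
      pairMaxwellian m kB δ n T u w (m * ‖v‖ ^ 2 + I + J) * (I * J) ^ (δ / 2 - 1) := by
  have h1 : ‖w + v - u‖ ^ 2 + ‖w - v - u‖ ^ 2 = 2 * ‖w - u‖ ^ 2 + 2 * ‖v‖ ^ 2 := by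
    have := parallelogram_law_with_norm ℝ (w - u) v
    rw [show w + v - u = w - u + v by abel, show w - v - u = w - u - v by abel]
    linarith
  have h2 : -(2 * m * ‖w - u‖ ^ 2 + 2 * (m * ‖v‖ ^ 2 + I + J)) / (2 * kB * T) =
      -(m * ‖w + v - u‖ ^ 2 + 2 * I) / (2 * kB * T) +
      -(m * ‖w - v - u‖ ^ 2 + 2 * J) / (2 * kB * T) := by
    rw [← add_div]
    congr 1
    linear_combination m * h1
  rw [pairMaxwellian, h2, Real.exp_add, Real.mul_rpow hI.le hJ.le]
  unfold Ms
  ring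

/-- The bilinear pair product of `M_s` and `M_s h`, divided by the powers of the internal
energies. -/
lemma Ms_pair_div (m kB δ n T : ℝ) (u w v : V3) {I J : ℝ} (hI : 0 < I) (hJ : 0 < J) (a b : ℝ) :
    (Ms m kB δ n T u (w + v) I * (Ms m kB δ n T u (w - v) J * b) +
      Ms m kB δ n T u (w - v) J * (Ms m kB δ n T u (w + v) I * a)) / (I * J) ^ (δ / 2 - 1) =
      pairMaxwellian m kB δ n T u w (m * ‖v‖ ^ 2 + I + J) * (a + b) := by
  have h0 : (I * J) ^ (δ / 2 - 1) ≠ 0 := (Real.rpow_pos_of_pos (mul_pos hI hJ) _).ne'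
  rw [div_eq_iff h0]
  linear_combination (a + b) * Ms_mul_Ms m kB δ n T u w v hI hJ

lemma norm_smul_sph (c : ℝ) (σ : Sph) : ‖c • (σ : V3)‖ = |c| := by
  rw [norm_smul, norm_eq_of_mem_sphere, mul_one, Real.norm_eq_abs]

lemma half_smul_add_add_sub (w v : V3) : (1 / 2 : ℝ) • (w + v + (w - v)) = w := by
  rw [show w + v + (w - v) = (2 : ℝ) • w by rw [two_smul]; abel, smul_smul]
  norm_num

lemma norm_add_sub_sub (w v : V3) : ‖w + v - (w - v)‖ = 2 * ‖v‖ := by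
  rw [show w + v - (w - v) = (2 : ℝ) • v by rw [two_smul]; abel, norm_smul]
  norm_num

lemma stdIntegrand_Ms {m kB δ n T α β Cs : ℝ} {u w : V3} (hm : 0 < m) {h : V3 → ℝ → ℝ}
    {E r R r' R' : ℝ} {σ σ' : Sph} (hE : 0 < E) (hr : r ∈ Set.Ioo (0 : ℝ) 1)
    (hR : R ∈ Set.Ioo (0 : ℝ) 1) (hr' : r' ∈ Set.Ioo (0 : ℝ) 1) (hR' : R' ∈ Set.Ioo (0 : ℝ) 1) :
    stdIntegrand m δ α β Cs (Ms m kB δ n T u) (fun x J => Ms m kB δ n T u x J * h x J)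
      (w + √(R * E / m) • (σ : V3)) (r * (1 - R) * E)
      (w - √(R * E / m) • (σ : V3)) ((1 - r) * (1 - R) * E) σ' r' R' =
    pairMaxwellian m kB δ n T u w E *
      (h (w + √(R' * E / m) • (σ' : V3)) (r' * (1 - R') * E) +
        h (w - √(R' * E / m) • (σ' : V3)) ((1 - r') * (1 - R') * E) -
        h (w + √(R * E / m) • (σ : V3)) (r * (1 - R) * E) -
        h (w - √(R * E / m) • (σ : V3)) ((1 - r) * (1 - R) * E)) *
    (Cs * ((1 - R) * E) ^ α * (2 * √(R * E / m)) ^ β *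
      (r * (1 - r) * ((1 - R) ^ 2 * E ^ 2)) ^ (δ / 2 - 1) *
      (r' * (1 - r')) ^ (δ / 2 - 1) * (1 - R') ^ (α + δ - 1) * R' ^ ((β + 1) / 2)) := by
  have hkin : ∀ {ρ : ℝ} (_ : ρ ∈ Set.Ioo (0 : ℝ) 1) (s : ℝ) (τ : Sph),
      m * ‖√(ρ * E / m) • (τ : V3)‖ ^ 2 + s * (1 - ρ) * E + (1 - s) * (1 - ρ) * E = E := by
    intro ρ hρ s τ
    have := hρ.1
    rw [norm_smul_sph, sq_abs, Real.sq_sqrt (by positivity)]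
    field_simp
    ring
  have hcoll : collE m (w + √(R * E / m) • (σ : V3)) (w - √(R * E / m) • (σ : V3))
      (r * (1 - R) * E) ((1 - r) * (1 - R) * E) = E := by
    rw [collE, norm_add_sub_sub]
    linear_combination hkin hR r σ
  have hpos : ∀ {s ρ : ℝ}, s ∈ Set.Ioo (0 : ℝ) 1 → ρ ∈ Set.Ioo (0 : ℝ) 1 →
      0 < s * (1 - ρ) * E ∧ 0 < (1 - s) * (1 - ρ) * E := fun hs hρ =>
    ⟨mul_pos (mul_pos hs.1 (sub_pos.2 hρ.2)) hE,
      mul_pos (mul_pos (sub_pos.2 hs.2) (sub_pos.2 hρ.2)) hE⟩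
  have h1 := Ms_pair_div m kB δ n T u w (√(R * E / m) • (σ : V3)) (hpos hr hR).1 (hpos hr hR).2
    (h (w + √(R * E / m) • (σ : V3)) (r * (1 - R) * E))
    (h (w - √(R * E / m) • (σ : V3)) ((1 - r) * (1 - R) * E))
  have h2 := Ms_pair_div m kB δ n T u w (√(R' * E / m) • (σ' : V3)) (hpos hr' hR').1
    (hpos hr' hR').2 (h (w + √(R' * E / m) • (σ' : V3)) (r' * (1 - R') * E))
    (h (w - √(R' * E / m) • (σ' : V3)) ((1 - r') * (1 - R') * E))
  rw [hkin hR] at h1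
  rw [hkin hR'] at h2
  simp only [stdIntegrand, xiPrimeStd, xiStarPrimeStd, IPrimeStd, IStarPrimeStd, hcoll,
    half_smul_add_add_sub]
  rw [h1, h2, norm_add_sub_sub, norm_smul_sph, abs_of_nonneg (Real.sqrt_nonneg _),
    show r * (1 - R) * E + (1 - r) * (1 - R) * E = (1 - R) * E by ring,
    show r * (1 - R) * E * ((1 - r) * (1 - R) * E) = r * (1 - r) * ((1 - R) ^ 2 * E ^ 2) by ring]
  ring

lemma resIntegrand_Ms {m kB δ n T α β Cr : ℝ} {u w : V3} {h : V3 → ℝ → ℝ}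
    {ρ S r r' : ℝ} {σ σ' : Sph} (hρ : 0 < ρ) (hS : 0 < S) (hr : r ∈ Set.Ioo (0 : ℝ) 1)
    (hr' : r' ∈ Set.Ioo (0 : ℝ) 1) :
    resIntegrand δ α β Cr (Ms m kB δ n T u) (fun x J => Ms m kB δ n T u x J * h x J)
      (w + ρ • (σ : V3)) (r * S) (w - ρ • (σ : V3)) ((1 - r) * S) σ' r' =
    pairMaxwellian m kB δ n T u w (m * ρ ^ 2 + S) *
      (h (w + ρ • (σ' : V3)) (r' * S) + h (w - ρ • (σ' : V3)) ((1 - r') * S) -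
        h (w + ρ • (σ : V3)) (r * S) - h (w - ρ • (σ : V3)) ((1 - r) * S)) *
    (Cr * S ^ α * (2 * ρ) ^ β * (r * (1 - r) * S ^ 2) ^ (δ / 2 - 1) *
      (r' * (1 - r')) ^ (δ / 2 - 1)) := by
  have hpos : ∀ {s : ℝ}, s ∈ Set.Ioo (0 : ℝ) 1 → 0 < s * S ∧ 0 < (1 - s) * S := fun hs =>
    ⟨mul_pos hs.1 hS, mul_pos (sub_pos.2 hs.2) hS⟩
  have h1 := Ms_pair_div m kB δ n T u w (ρ • (σ : V3)) (hpos hr).1 (hpos hr).2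
    (h (w + ρ • (σ : V3)) (r * S)) (h (w - ρ • (σ : V3)) ((1 - r) * S))
  have h2 := Ms_pair_div m kB δ n T u w (ρ • (σ' : V3)) (hpos hr').1 (hpos hr').2
    (h (w + ρ • (σ' : V3)) (r' * S)) (h (w - ρ • (σ' : V3)) ((1 - r') * S))
  have hsum : ∀ s : ℝ, s * S + (1 - s) * S = S := fun s => by ring
  have hrel : ‖w + ρ • (σ : V3) - (w - ρ • (σ : V3))‖ = 2 * ρ := by
    rw [norm_add_sub_sub, norm_smul_sph, abs_of_pos hρ]
  rw [norm_smul_sph, sq_abs, add_assoc, hsum] at h1 h2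
  simp only [resIntegrand, xiPrimeRes, xiStarPrimeRes, IPrimeRes, IStarPrimeRes, hrel, hsum,
    half_smul_add_add_sub, mul_div_cancel_left₀ ρ (two_ne_zero' ℝ)]
  rw [h1, h2, show r * S * ((1 - r) * S) = r * (1 - r) * S ^ 2 by ring]
  ring

lemma measurePreserving_one_sub_Ioo :
    MeasurePreserving (fun r : ℝ => 1 - r) (volume.restrict (Set.Ioo (0 : ℝ) 1))
      (volume.restrict (Set.Ioo (0 : ℝ) 1)) := by
  have h := (Measure.measurePreserving_sub_left (volume : Measure ℝ) 1).restrict_preimage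
    (measurableSet_Ioo (a := (0 : ℝ)) (b := 1))
  have h2 : (fun r : ℝ => 1 - r) ⁻¹' Set.Ioo (0 : ℝ) 1 = Set.Ioo 0 1 := by
    simp
  rwa [h2] at h

lemma stdMeasure_eq : stdMeasure = (volume : Measure V3).prod
    ((volume.restrict (Set.Ioi (0 : ℝ))).prod ((volume : Measure V3).prod
      ((volume.restrict (Set.Ioi (0 : ℝ))).prod (sphMeasure.prod
        ((volume.restrict (Set.Ioo (0 : ℝ) 1)).prod (volume.restrict (Set.Ioo (0 : ℝ) 1))))))) := by
  rw [stdMeasure, ← restrict_Ioi_eq_restrict_Ici, ← restrict_Ioo_eq_restrict_Icc]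

lemma resMeasure_eq : resMeasure = (volume : Measure V3).prod
    ((volume.restrict (Set.Ioi (0 : ℝ))).prod ((volume : Measure V3).prod
      ((volume.restrict (Set.Ioi (0 : ℝ))).prod (sphMeasure.prod
        (volume.restrict (Set.Ioo (0 : ℝ) 1)))))) := by
  rw [resMeasure, ← restrict_Ioi_eq_restrict_Ici, ← restrict_Ioo_eq_restrict_Icc]

/-- The weight of the parameters `(σ, r, R)` of a standard collision. -/
def stdWeight (δ α β : ℝ) (q : Sph × ℝ × ℝ) : ℝ :=
  (q.2.1 * (1 - q.2.1)) ^ (δ / 2 - 1) * (1 - q.2.2) ^ (α + δ - 1) * q.2.2 ^ ((β + 1) / 2)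

/-- The energy dependence of the collision kernel of a standard collision. -/
def stdEnergyWeight (m δ α β Cs E : ℝ) : ℝ :=
  4 / m * √(E / m) * E ^ 2 * Cs * E ^ α * (2 * √(E / m)) ^ β * (E ^ 2) ^ (δ / 2 - 1)

lemma stdWeight_factor {m δ α β Cs E : ℝ} (hm : 0 < m) (hE : 0 < E) {q : Sph × ℝ × ℝ}
    (hr : q.2.1 ∈ Set.Ioo (0 : ℝ) 1) (hR : q.2.2 ∈ Set.Ioo (0 : ℝ) 1) :
    4 / m * √(q.2.2 * E / m) * ((1 - q.2.2) * E) * E *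
      (Cs * ((1 - q.2.2) * E) ^ α * (2 * √(q.2.2 * E / m)) ^ β *
        (q.2.1 * (1 - q.2.1) * ((1 - q.2.2) ^ 2 * E ^ 2)) ^ (δ / 2 - 1)) =
      stdEnergyWeight m δ α β Cs E * stdWeight δ α β q := by
  obtain ⟨σ, r, R⟩ := q
  obtain ⟨hr0, hr1⟩ := hr
  obtain ⟨hR0, hR1⟩ := hR
  dsimp only at *
  have hs : 0 < 1 - r := sub_pos.2 hr1
  have hS : 0 < 1 - R := sub_pos.2 hR1
  have h1 : √(R * E / m) = √R * √(E / m) := by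
    rw [mul_div_assoc, Real.sqrt_mul hR0.le]
  have h2 : R ^ ((β + 1) / 2) = √R * √R ^ β := by
    rw [Real.sqrt_eq_rpow, ← Real.rpow_mul hR0.le, ← Real.rpow_add hR0]
    congr 1
    ring
  have h3 : (1 - R) ^ (α + δ - 1) = (1 - R) * (1 - R) ^ α * ((1 - R) ^ 2) ^ (δ / 2 - 1) := by
    rw [← Real.rpow_natCast, ← Real.rpow_mul hS.le]
    nth_rewrite 2 [← Real.rpow_one (1 - R)]
    rw [← Real.rpow_add hS, ← Real.rpow_add hS]
    congr 1
    push_cast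
    ring
  rw [stdEnergyWeight, stdWeight, h1, h2, h3, Real.mul_rpow hS.le hE.le,
    show 2 * (√R * √(E / m)) = √R * (2 * √(E / m)) by ring,
    Real.mul_rpow (Real.sqrt_nonneg _) (by positivity),
    Real.mul_rpow (mul_nonneg hr0.le hs.le) (by positivity),
    Real.mul_rpow (sq_nonneg (1 - R)) (sq_nonneg E)]
  ring

lemma ae_sphere_Ioo_Ioo : ∀ᵐ q ∂(sphMeasure.prod ((volume.restrict (Set.Ioo (0 : ℝ) 1)).prod
    (volume.restrict (Set.Ioo (0 : ℝ) 1)))),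
    q.2.1 ∈ Set.Ioo (0 : ℝ) 1 ∧ q.2.2 ∈ Set.Ioo (0 : ℝ) 1 := by
  have h : ∀ᵐ r ∂(volume.restrict (Set.Ioo (0 : ℝ) 1)), r ∈ Set.Ioo (0 : ℝ) 1 :=
    ae_restrict_mem measurableSet_Ioo
  exact Measure.quasiMeasurePreserving_snd.ae ((Measure.quasiMeasurePreserving_fst.ae h).and
    (Measure.quasiMeasurePreserving_snd.ae h))

lemma ae_parameters {X Y : Type*} [MeasurableSpace X] [MeasurableSpace Y]
    {η : Measure X} {ν : Measure Y} [SFinite η] [SFinite ν] {P : X → Prop} {Q : Y → Prop}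
    (hP : ∀ᵐ x ∂η, P x) (hQ : ∀ᵐ q ∂ν, Q q) :
    ∀ᵐ p ∂(η.prod (ν.prod ν)), P p.1 ∧ Q p.2.1 ∧ Q p.2.2 :=
  (Measure.quasiMeasurePreserving_fst.ae hP).and (Measure.quasiMeasurePreserving_snd.ae
    ((Measure.quasiMeasurePreserving_fst.ae hQ).and (Measure.quasiMeasurePreserving_snd.ae hQ)))

/-- The Dirichlet form of the standard linearized collision operator. -/
lemma exists_dirichletForm_std (m kB δ n T α β Cs : ℝ) (u : V3) (hm : 0 < m) (hCs : 0 < Cs) :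
    ∃ D : (V3 → ℝ → ℝ) → (V3 → ℝ → ℝ) → ℝ, (∀ h g, D h g = D g h) ∧ (∀ h, 0 ≤ D h h) ∧
      ∀ h g : V3 → ℝ → ℝ, Integrable (fun p : V3 × ℝ × V3 × ℝ × Sph × ℝ × ℝ =>
        stdIntegrand m δ α β Cs (Ms m kB δ n T u) (fun x J => Ms m kB δ n T u x J * h x J)
          p.1 p.2.1 p.2.2.1 p.2.2.2.1 p.2.2.2.2.1 p.2.2.2.2.2.1 p.2.2.2.2.2.2 *
            g p.1 p.2.1) stdMeasure →
      4 * ∫ p : V3 × ℝ × V3 × ℝ × Sph × ℝ × ℝ,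
        stdIntegrand m δ α β Cs (Ms m kB δ n T u) (fun x J => Ms m kB δ n T u x J * h x J)
          p.1 p.2.1 p.2.2.1 p.2.2.2.1 p.2.2.2.2.1 p.2.2.2.2.2.1 p.2.2.2.2.2.2 *
            g p.1 p.2.1 ∂stdMeasure = -D h g := by
  let A : (V3 × ℝ) × (Sph × ℝ × ℝ) → V3 × ℝ := fun z =>
    (z.1.1 + √(z.2.2.2 * z.1.2 / m) • (z.2.1 : V3), z.2.2.1 * (1 - z.2.2.2) * z.1.2)
  let B : (V3 × ℝ) × (Sph × ℝ × ℝ) → V3 × ℝ := fun z =>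
    (z.1.1 - √(z.2.2.2 * z.1.2 / m) • (z.2.1 : V3), (1 - z.2.2.1) * (1 - z.2.2.2) * z.1.2)
  let J : (V3 × ℝ) × (Sph × ℝ × ℝ) → ℝ := fun z =>
    4 / m * √(z.2.2.2 * z.1.2 / m) * ((1 - z.2.2.2) * z.1.2) * z.1.2
  let k : V3 × ℝ → Sph × ℝ × ℝ → Sph × ℝ × ℝ → ℝ := fun x q q' =>
    pairMaxwellian m kB δ n T u x.1 x.2 *
      |stdEnergyWeight m δ α β Cs x.2 * (stdWeight δ α β q * stdWeight δ α β q')|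
  let j : Sph × ℝ × ℝ → Sph × ℝ × ℝ := Prod.map (fun σ => -σ) (Prod.map (fun r => 1 - r) id)
  have hA : Measurable A := by fun_prop
  have hB : Measurable B := by fun_prop
  have hJ : Measurable J := by fun_prop
  have hj : MeasurePreserving j (sphMeasure.prod ((volume.restrict (Set.Ioo (0 : ℝ) 1)).prod
      (volume.restrict (Set.Ioo (0 : ℝ) 1)))) (sphMeasure.prod
      ((volume.restrict (Set.Ioo (0 : ℝ) 1)).prod (volume.restrict (Set.Ioo (0 : ℝ) 1)))) :=
    measurePreserving_neg_sphMeasure.prod (measurePreserving_one_sub_Ioo.prod (.id _))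
  have hae : ∀ᵐ x ∂((volume : Measure V3).prod (volume.restrict (Set.Ioi (0 : ℝ)))), 0 < x.2 :=
    Measure.quasiMeasurePreserving_snd.ae (ae_restrict_mem measurableSet_Ioi)
  refine ⟨fun h g => ∫ p : (V3 × ℝ) × ((Sph × ℝ × ℝ) × (Sph × ℝ × ℝ)), k p.1 p.2.1 p.2.2 *
      (h (A (p.1, p.2.2)).1 (A (p.1, p.2.2)).2 + h (B (p.1, p.2.2)).1 (B (p.1, p.2.2)).2 -
        h (A (p.1, p.2.1)).1 (A (p.1, p.2.1)).2 - h (B (p.1, p.2.1)).1 (B (p.1, p.2.1)).2) *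
      (g (A (p.1, p.2.2)).1 (A (p.1, p.2.2)).2 + g (B (p.1, p.2.2)).1 (B (p.1, p.2.2)).2 -
        g (A (p.1, p.2.1)).1 (A (p.1, p.2.1)).2 - g (B (p.1, p.2.1)).1 (B (p.1, p.2.1)).2)
      ∂(((volume : Measure V3).prod (volume.restrict (Set.Ioi (0 : ℝ)))).prod
        ((sphMeasure.prod ((volume.restrict (Set.Ioo (0 : ℝ) 1)).prod
          (volume.restrict (Set.Ioo (0 : ℝ) 1)))).prod (sphMeasure.prod
        ((volume.restrict (Set.Ioo (0 : ℝ) 1)).prod (volume.restrict (Set.Ioo (0 : ℝ) 1)))))),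
    fun h g => integral_congr_ae (.of_forall fun p => mul_right_comm _ _ _), fun h => ?_,
    fun h g hint => ?_⟩
  · refine integral_nonneg fun p => ?_
    dsimp only
    rw [mul_assoc]
    exact mul_nonneg (mul_nonneg (pairMaxwellian_nonneg ..) (abs_nonneg _)) (mul_self_nonneg _)
  · rw [stdMeasure_eq] at hint ⊢
    refine integral_collision_form (f := fun p => stdIntegrand m δ α β Cs (Ms m kB δ n T u)
      (fun x J => Ms m kB δ n T u x J * h x J)
          p.1 p.2.1 p.2.2.1 p.2.2.2.1 p.2.2.2.2.1 p.2.2.2.2.2.1 p.2.2.2.2.2.2) (j := j)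
      hA hB hJ (fun F hF => ?_) hj (fun x q => ?_) (fun x q => ?_) (fun x q q' => ?_)
      (fun x q q' => ?_) ?_ hint
    · rw [lintegral_twoParticle_standard hm hF, lintegral_prod]
      have hm1 : Measurable fun z : (V3 × ℝ) × (Sph × ℝ × ℝ) => ENNReal.ofReal (J z) *
        F ((A z).1, (A z).2, (B z).1, (B z).2) := by fun_prop
      exact hm1.lintegral_prod_right'.aemeasurable
    · simp [A, B, j, sub_eq_add_neg]
    · simp [A, B, j, sub_eq_add_neg]
    · simp only [k, mul_comm (stdWeight δ α β q)]
    · simp only [k, j, stdWeight, Prod.map_fst, Prod.map_snd, id, sub_sub_cancel,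
        mul_comm (1 - q.2.1)]
    · filter_upwards [ae_parameters hae ae_sphere_Ioo_Ioo] with ⟨⟨w, E⟩, q, q'⟩ hp
      obtain ⟨hE, ⟨hr, hR⟩, hr', hR'⟩ := hp
      have hpos : ∀ {q : Sph × ℝ × ℝ}, q.2.1 ∈ Set.Ioo (0 : ℝ) 1 → q.2.2 ∈ Set.Ioo (0 : ℝ) 1 →
          0 ≤ stdWeight δ α β q := fun hr hR =>
        mul_nonneg (mul_nonneg (Real.rpow_nonneg (mul_nonneg hr.1.le (sub_nonneg.2 hr.2.le)) _)
          (Real.rpow_nonneg (sub_nonneg.2 hR.2.le) _)) (Real.rpow_nonneg hR.1.le _)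
      have hc : 0 ≤ stdEnergyWeight m δ α β Cs E := by
        dsimp only at hE
        unfold stdEnergyWeight
        positivity
      have hJ0 : 0 ≤ J ((w, E), q) := by
        have h1 : 0 ≤ 1 - q.2.2 := sub_nonneg.2 hR.2.le
        have h2 : 0 ≤ E := hE.le
        dsimp only [J]
        positivity
      simp only [A, B]
      rw [stdIntegrand_Ms hm hE hr hR hr' hR', max_eq_left hJ0]
      simp only [k]
      rw [abs_of_nonneg (mul_nonneg hc (mul_nonneg (hpos hr hR) (hpos hr' hR'))), ← mul_assoc
        (stdEnergyWeight m δ α β Cs E), ← stdWeight_factor hm hE hr hR]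
      simp only [stdWeight, J]
      ring

lemma ae_sphere_Ioo : ∀ᵐ q ∂(sphMeasure.prod (volume.restrict (Set.Ioo (0 : ℝ) 1))),
    q.2 ∈ Set.Ioo (0 : ℝ) 1 :=
  Measure.quasiMeasurePreserving_snd.ae (ae_restrict_mem measurableSet_Ioo)

/-- The Dirichlet form of the resonant linearized collision operator. -/
lemma exists_dirichletForm_res (m kB δ n T α β Cr : ℝ) (u : V3) (hCr : 0 < Cr) :
    ∃ D : (V3 → ℝ → ℝ) → (V3 → ℝ → ℝ) → ℝ, (∀ h g, D h g = D g h) ∧ (∀ h, 0 ≤ D h h) ∧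
      ∀ h g : V3 → ℝ → ℝ, Integrable (fun p : V3 × ℝ × V3 × ℝ × Sph × ℝ =>
        resIntegrand δ α β Cr (Ms m kB δ n T u) (fun x J => Ms m kB δ n T u x J * h x J)
          p.1 p.2.1 p.2.2.1 p.2.2.2.1 p.2.2.2.2.1 p.2.2.2.2.2 * g p.1 p.2.1) resMeasure →
      4 * ∫ p : V3 × ℝ × V3 × ℝ × Sph × ℝ,
        resIntegrand δ α β Cr (Ms m kB δ n T u) (fun x J => Ms m kB δ n T u x J * h x J)
          p.1 p.2.1 p.2.2.1 p.2.2.2.1 p.2.2.2.2.1 p.2.2.2.2.2 * g p.1 p.2.1 ∂resMeasure =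
        -D h g := by
  let A : (V3 × ℝ × ℝ) × (Sph × ℝ) → V3 × ℝ := fun z =>
    (z.1.1 + z.1.2.1 • (z.2.1 : V3), z.2.2 * z.1.2.2)
  let B : (V3 × ℝ × ℝ) × (Sph × ℝ) → V3 × ℝ := fun z =>
    (z.1.1 - z.1.2.1 • (z.2.1 : V3), (1 - z.2.2) * z.1.2.2)
  let J : (V3 × ℝ × ℝ) × (Sph × ℝ) → ℝ := fun z => 8 * z.1.2.1 ^ 2 * z.1.2.2
  let c : V3 × ℝ × ℝ → ℝ := fun x =>
    8 * x.2.1 ^ 2 * x.2.2 * Cr * x.2.2 ^ α * (2 * x.2.1) ^ β * (x.2.2 ^ 2) ^ (δ / 2 - 1)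
  let W : Sph × ℝ → ℝ := fun q => (q.2 * (1 - q.2)) ^ (δ / 2 - 1)
  let k : V3 × ℝ × ℝ → Sph × ℝ → Sph × ℝ → ℝ := fun x q q' =>
    pairMaxwellian m kB δ n T u x.1 (m * x.2.1 ^ 2 + x.2.2) * |c x * (W q * W q')|
  let j : Sph × ℝ → Sph × ℝ := Prod.map (fun σ => -σ) (fun r => 1 - r)
  have hA : Measurable A := by fun_prop
  have hB : Measurable B := by fun_prop
  have hJ : Measurable J := by fun_prop
  have hj : MeasurePreserving j (sphMeasure.prod (volume.restrict (Set.Ioo (0 : ℝ) 1)))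
      (sphMeasure.prod (volume.restrict (Set.Ioo (0 : ℝ) 1))) :=
    measurePreserving_neg_sphMeasure.prod measurePreserving_one_sub_Ioo
  have hpos : ∀ᵐ s ∂(volume.restrict (Set.Ioi (0 : ℝ))), 0 < s := ae_restrict_mem measurableSet_Ioi
  have hae : ∀ᵐ x ∂((volume : Measure V3).prod ((volume.restrict (Set.Ioi (0 : ℝ))).prod
      (volume.restrict (Set.Ioi (0 : ℝ))))), 0 < x.2.1 ∧ 0 < x.2.2 :=
    Measure.quasiMeasurePreserving_snd.ae ((Measure.quasiMeasurePreserving_fst.ae hpos).and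
      (Measure.quasiMeasurePreserving_snd.ae hpos))
  refine ⟨fun h g => ∫ p : (V3 × ℝ × ℝ) × ((Sph × ℝ) × (Sph × ℝ)), k p.1 p.2.1 p.2.2 *
      (h (A (p.1, p.2.2)).1 (A (p.1, p.2.2)).2 + h (B (p.1, p.2.2)).1 (B (p.1, p.2.2)).2 -
        h (A (p.1, p.2.1)).1 (A (p.1, p.2.1)).2 - h (B (p.1, p.2.1)).1 (B (p.1, p.2.1)).2) *
      (g (A (p.1, p.2.2)).1 (A (p.1, p.2.2)).2 + g (B (p.1, p.2.2)).1 (B (p.1, p.2.2)).2 -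
        g (A (p.1, p.2.1)).1 (A (p.1, p.2.1)).2 - g (B (p.1, p.2.1)).1 (B (p.1, p.2.1)).2)
      ∂(((volume : Measure V3).prod ((volume.restrict (Set.Ioi (0 : ℝ))).prod
        (volume.restrict (Set.Ioi (0 : ℝ))))).prod
        ((sphMeasure.prod (volume.restrict (Set.Ioo (0 : ℝ) 1))).prod
          (sphMeasure.prod (volume.restrict (Set.Ioo (0 : ℝ) 1))))),
    fun h g => integral_congr_ae (.of_forall fun p => mul_right_comm _ _ _), fun h => ?_,
    fun h g hint => ?_⟩
  · refine integral_nonneg fun p => ?_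
    dsimp only
    rw [mul_assoc]
    exact mul_nonneg (mul_nonneg (pairMaxwellian_nonneg ..) (abs_nonneg _)) (mul_self_nonneg _)
  · rw [resMeasure_eq] at hint ⊢
    refine integral_collision_form (f := fun p => resIntegrand δ α β Cr (Ms m kB δ n T u)
      (fun x J => Ms m kB δ n T u x J * h x J)
          p.1 p.2.1 p.2.2.1 p.2.2.2.1 p.2.2.2.2.1 p.2.2.2.2.2) (j := j)
      hA hB hJ (fun F hF => ?_) hj (fun x q => ?_) (fun x q => ?_) (fun x q q' => ?_)
      (fun x q q' => ?_) ?_ hint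
    · have hm1 : Measurable fun z : (V3 × ℝ × ℝ) × (Sph × ℝ) => ENNReal.ofReal (J z) *
        F ((A z).1, (A z).2, (B z).1, (B z).2) := by fun_prop
      have hm2 : Measurable fun x => ∫⁻ q, ENNReal.ofReal (J (x, q)) *
          F ((A (x, q)).1, (A (x, q)).2, (B (x, q)).1, (B (x, q)).2)
          ∂(sphMeasure.prod (volume.restrict (Set.Ioo (0 : ℝ) 1))) := hm1.lintegral_prod_right'
      rw [lintegral_twoParticle_resonant hF, lintegral_prod _ hm2.aemeasurable]
      refine lintegral_congr fun w => ?_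
      rw [lintegral_prod _ (by fun_prop)]
    · simp [A, B, j, sub_eq_add_neg]
    · simp [A, B, j, sub_eq_add_neg]
    · simp only [k, mul_comm (W q)]
    · simp only [k, j, W, Prod.map_snd, sub_sub_cancel, mul_comm (1 - q.2)]
    · filter_upwards [ae_parameters hae ae_sphere_Ioo] with ⟨⟨w, ρ, S⟩, q, q'⟩ hp
      obtain ⟨⟨hρ, hS⟩, hr, hr'⟩ := hp
      dsimp only at hρ hS hr hr'
      have hrr : ∀ {r : ℝ}, r ∈ Set.Ioo (0 : ℝ) 1 → 0 ≤ r * (1 - r) := fun hr =>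
        mul_nonneg hr.1.le (sub_nonneg.2 hr.2.le)
      have hc : 0 ≤ c (w, ρ, S) := by
        dsimp only [c]
        positivity
      have hJ0 : 0 ≤ J ((w, ρ, S), q) := by
        dsimp only [J]
        positivity
      simp only [A, B]
      rw [resIntegrand_Ms hρ hS hr hr', max_eq_left hJ0]
      simp only [k]
      rw [abs_of_nonneg (mul_nonneg hc (mul_nonneg (Real.rpow_nonneg (hrr hr) _)
        (Real.rpow_nonneg (hrr hr') _))), Real.mul_rpow (hrr hr) (sq_nonneg S)]
      simp only [c, J]
      ring

lemma Ms_pos {m kB δ n T : ℝ} (hm : 0 < m) (hkB : 0 < kB) (hδ : 0 < δ) (hn : 0 < n) (hT : 0 < T)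
    (u ξ : V3) {I : ℝ} (hI : 0 < I) : 0 < Ms m kB δ n T u ξ I := by
  have := Real.Gamma_pos_of_pos (half_pos hδ)
  unfold Ms
  positivity

/-- for `θ ∈ (0,1]`, the linearized collision operator `L_θ` is symmetric
and nonnegative with respect to the Maxwellian-weighted inner product. -/
theorem Ltheta_symmetric_nonneg (m kB δ α β Cr Cs : ℝ) (hm : 0 < m) (hkB : 0 < kB) (hδ : 2 ≤ δ)
    (hα : α ∈ Set.Ico (0:ℝ) (δ / 2)) (hβ : β ∈ Set.Icc (0:ℝ) 1) (hCr : 0 < Cr)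
    (hCs : Cs = Real.Gamma (δ + α + (β + 3) / 2) /
      (Real.Gamma ((β + 3) / 2) * Real.Gamma (δ + α)) * Cr)
    (n T : ℝ) (hn : 0 < n) (hT : 0 < T) (u : V3)
    (θ : ℝ) (hθ : θ ∈ Set.Ioc (0:ℝ) 1)
    (h g : V3 → ℝ → ℝ)
    (hh : Measurable (Function.uncurry h)) (hg : Measurable (Function.uncurry g))
    (hint : ∀ h' g' : V3 → ℝ → ℝ,
      ((h' = h ∧ g' = g) ∨ (h' = g ∧ g' = h) ∨ (h' = h ∧ g' = h)) →
      Integrable (fun p : V3 × ℝ =>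
          Ltheta m kB δ n T α β Cr Cs θ u h' p.1 p.2 * g' p.1 p.2 *
            Ms m kB δ n T u p.1 p.2) phaseMeasure ∧
      Integrable (fun p : V3 × ℝ × V3 × ℝ × Sph × ℝ × ℝ =>
          stdIntegrand m δ α β Cs (Ms m kB δ n T u)
              (fun x J => Ms m kB δ n T u x J * h' x J)
              p.1 p.2.1 p.2.2.1 p.2.2.2.1 p.2.2.2.2.1 p.2.2.2.2.2.1 p.2.2.2.2.2.2 *
            g' p.1 p.2.1) stdMeasure ∧
      Integrable (fun p : V3 × ℝ × V3 × ℝ × Sph × ℝ =>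
          resIntegrand δ α β Cr (Ms m kB δ n T u)
              (fun x J => Ms m kB δ n T u x J * h' x J)
              p.1 p.2.1 p.2.2.1 p.2.2.2.1 p.2.2.2.2.1 p.2.2.2.2.2 *
            g' p.1 p.2.1) resMeasure) :
    (∫ p, Ltheta m kB δ n T α β Cr Cs θ u h p.1 p.2 * g p.1 p.2 *
        Ms m kB δ n T u p.1 p.2 ∂phaseMeasure) =
      (∫ p, h p.1 p.2 * Ltheta m kB δ n T α β Cr Cs θ u g p.1 p.2 *
        Ms m kB δ n T u p.1 p.2 ∂phaseMeasure) ∧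
    0 ≤ (∫ p, Ltheta m kB δ n T α β Cr Cs θ u h p.1 p.2 * h p.1 p.2 *
        Ms m kB δ n T u p.1 p.2 ∂phaseMeasure) := by
  have hδ0 : 0 < δ := by linarith
  have hCs0 : 0 < Cs := by
    have h1 := Real.Gamma_pos_of_pos (s := δ + α + (β + 3) / 2) (by linarith [hα.1, hβ.1])
    have h2 := Real.Gamma_pos_of_pos (s := (β + 3) / 2) (by linarith [hβ.1])
    have h3 := Real.Gamma_pos_of_pos (s := δ + α) (by linarith [hα.1])
    rw [hCs]
    positivity
  obtain ⟨Ds, hDs, hDs0, hDs'⟩ := exists_dirichletForm_std m kB δ n T α β Cs u hm hCs0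
  obtain ⟨Dr, hDr, hDr0, hDr'⟩ := exists_dirichletForm_res m kB δ n T α β Cr u hCr
  have key : ∀ h' g' : V3 → ℝ → ℝ,
      ((h' = h ∧ g' = g) ∨ (h' = g ∧ g' = h) ∨ (h' = h ∧ g' = h)) →
      ∫ p, Ltheta m kB δ n T α β Cr Cs θ u h' p.1 p.2 * g' p.1 p.2 *
        Ms m kB δ n T u p.1 p.2 ∂phaseMeasure = (θ * Ds h' g' + (1 - θ) * Dr h' g') / 4 := by
    intro h' g' hc
    obtain ⟨-, his, hir⟩ := hint h' g' hc
    obtain ⟨is, es⟩ := integral_Qs_mul his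
    obtain ⟨ir, er⟩ := integral_Qr_mul hir
    have hs := hDs' h' g' his
    have hr := hDr' h' g' hir
    have hpos : ∀ᵐ p ∂phaseMeasure, 0 < p.2 := by
      rw [phaseMeasure, ← restrict_Ioi_eq_restrict_Ici]
      exact Measure.quasiMeasurePreserving_snd.ae (ae_restrict_mem measurableSet_Ioi)
    have hL : (fun p : V3 × ℝ => Ltheta m kB δ n T α β Cr Cs θ u h' p.1 p.2 * g' p.1 p.2 *
        Ms m kB δ n T u p.1 p.2) =ᵐ[phaseMeasure] fun p =>
        -2 * θ * (Qs m δ α β Cs (Ms m kB δ n T u) (fun x J => Ms m kB δ n T u x J * h' x J)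
          p.1 p.2 * g' p.1 p.2) +
        -2 * (1 - θ) * (Qr δ α β Cr (Ms m kB δ n T u) (fun x J => Ms m kB δ n T u x J * h' x J)
          p.1 p.2 * g' p.1 p.2) := by
      filter_upwards [hpos] with p hp
      have hM := (Ms_pos hm hkB hδ0 hn hT u p.1 hp).ne'
      rw [Ltheta]
      field_simp
      ring
    rw [integral_congr_ae hL, integral_add (is.const_mul _) (ir.const_mul _),
      integral_const_mul, integral_const_mul, es, er]
    linear_combination -θ / 4 * hs - (1 - θ) / 4 * hr
  refine ⟨?_, ?_⟩
  · rw [key h g (.inl ⟨rfl, rfl⟩), hDs, hDr, ← key g h (.inr (.inl ⟨rfl, rfl⟩))]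
    exact integral_congr_ae (.of_forall fun p => by ring)
  · rw [key h h (.inr (.inr ⟨rfl, rfl⟩))]
    have := mul_nonneg hθ.1.le (hDs0 h)
    have := mul_nonneg (sub_nonneg.2 hθ.2) (hDr0 h)
    positivity
end
end

section
/- Characterization of resonant collision invariants: let g : ℝ³ × [0,∞) → ℝ be continuous and suppose that g(ξ,I) + g(ξ_*,I_*) = g(ξ',I') + g(ξ_*',I_*') for all ξ, ξ_* ∈ ℝ³, I, I_* ≥ 0, r ∈ [0,1], σ ∈ S², where (ξ', ξ_*', I', I_*') are the resonant Borgnakke–Larsen collision variables. Then there exist a ∈ ℝ, b ∈ ℝ³, c ∈ ℝ, d ∈ ℝ such that g(ξ,I) = a + b·ξ + c|ξ|² + d I for all ξ ∈ ℝ³ and I ≥ 0. -/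
noncomputable section

open MeasureTheory Real
open scoped BigOperators RealInnerProductSpace

/-- A function that is continuous and additive on `[0, ∞)` is linear there. -/
lemma eq_mul_of_additiveOn_Ici {h : ℝ → ℝ} (hc : ContinuousOn h (Set.Ici 0))
    (hadd : ∀ s t, 0 ≤ s → 0 ≤ t → h (s + t) = h s + h t) {t : ℝ} (ht : 0 ≤ t) :
    h t = h 1 * t := by
  have h0 : h 0 = 0 := by simpa using hadd 0 0 le_rfl le_rfl
  have hcp : Continuous fun t : ℝ => h (max t 0) :=
    hc.comp_continuous (by fun_prop) fun t => le_max_right t 0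
  let H : ℝ →+ ℝ := AddMonoidHom.mk' (fun t => h (max t 0) - h (max (-t) 0)) (by
    intro s t
    have key : max (s + t) 0 + (max (-s) 0 + max (-t) 0) =
        max (-(s + t)) 0 + (max s 0 + max t 0) := by
      have (x : ℝ) : max x 0 = max (-x) 0 + x := by
        rcases le_total x 0 with hx | hx <;> simp [hx]
      linarith [this (s + t), this s, this t]
    have e := congrArg h key
    rw [hadd _ _ (by positivity) (by positivity), hadd _ _ (by positivity) (by positivity),
      hadd _ _ (by positivity) (by positivity), hadd _ _ (by positivity) (by positivity)] at e
    linarith)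
  have hH : Continuous H := hcp.sub (hcp.comp continuous_neg)
  have hpos (s : ℝ) (hs : 0 ≤ s) : H s = h s := by
    change h (max s 0) - h (max (-s) 0) = h s
    simp [hs, h0]
  have := map_real_smul H hH t 1
  simp only [smul_eq_mul, mul_one] at this
  rw [hpos t ht, hpos 1 zero_le_one] at this
  linarith

section ElasticInvariant

variable {E : Type*} [NormedAddCommGroup E]

/-- `f x + f y` depends only on the total momentum and the relative speed of `x` and `y`. -/
def IsElasticInvariant (f : E → ℝ) : Prop :=
  ∀ x y z w : E, x + y = z + w → ‖x - y‖ = ‖z - w‖ → f x + f y = f z + f w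

lemma IsElasticInvariant.comp_neg {f : E → ℝ} (hf : IsElasticInvariant f) :
    IsElasticInvariant fun x => f (-x) := by
  intro x y z w h₁ h₂
  refine hf _ _ _ _ ?_ ?_
  · rw [← neg_add, h₁, neg_add]
  · rw [← neg_sub', ← neg_sub', norm_neg, norm_neg, h₂]

variable [InnerProductSpace ℝ E]

lemma norm_add_eq_norm_sub_of_inner_eq_zero {u v : E} (h : ⟪u, v⟫ = 0) :
    ‖u + v‖ = ‖u - v‖ := by
  rw [← sq_eq_sq₀ (norm_nonneg _) (norm_nonneg _), norm_add_sq_real, norm_sub_sq_real, h]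
  ring

lemma IsElasticInvariant.map_add_of_inner_eq_zero {f : E → ℝ} (hf : IsElasticInvariant f)
    (h0 : f 0 = 0) {u v : E} (h : ⟪u, v⟫ = 0) : f (u + v) = f u + f v := by
  have := hf (u + v) 0 u v (by simp) (by simpa using norm_add_eq_norm_sub_of_inner_eq_zero h)
  linarith

/-- An odd elastic invariant is additive in dimension at least two. -/
lemma IsElasticInvariant.map_add_of_odd {f : E → ℝ} (hf : IsElasticInvariant f)
    (hodd : ∀ x, f (-x) = -f x) (hperp : ∀ v : E, ∃ σ : E, ‖σ‖ = 1 ∧ ⟪v, σ⟫ = 0) (x y : E) :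
    f (x + y) = f x + f y := by
  have h0 : f 0 = 0 := by
    have := hodd 0
    rw [neg_zero] at this
    linarith
  have orth_sub {u v : E} (h : ⟪u, v⟫ = 0) : f (u - v) = f u - f v := by
    rw [sub_eq_add_neg, hf.map_add_of_inner_eq_zero h0 (by simpa using h), hodd, sub_eq_add_neg]
  have inner_add_sub {u v : E} (h : ‖u‖ = ‖v‖) : ⟪u + v, u - v⟫ = 0 :=
    (real_inner_add_sub_eq_zero_iff u v).2 h
  have double (u : E) : f (u + u) = 2 * f u := by
    obtain ⟨σ, hσ, hu⟩ := hperp u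
    have huv : ⟪u, ‖u‖ • σ⟫ = 0 := by rw [inner_smul_right, hu, mul_zero]
    have hnorm : ‖u‖ = ‖‖u‖ • σ‖ := by simp [norm_smul, hσ]
    have e := hf.map_add_of_inner_eq_zero h0 (inner_add_sub hnorm)
    rw [hf.map_add_of_inner_eq_zero h0 huv, orth_sub huv] at e
    rw [show u + u = u + ‖u‖ • σ + (u - ‖u‖ • σ) by abel, e]
    ring
  have add_of_norm_eq {u v : E} (h : ‖u‖ = ‖v‖) : f (u + v) = f u + f v := by
    have e₁ := hf.map_add_of_inner_eq_zero h0 (inner_add_sub h)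
    have e₂ := orth_sub (inner_add_sub h)
    rw [show u + v + (u - v) = u + u by abel, double] at e₁
    rw [show u + v - (u - v) = v + v by abel, double] at e₂
    linarith
  obtain ⟨σ, hσ, hxy⟩ := hperp (x + y)
  set p : E := (1 / 2 : ℝ) • (x + y) with hp
  set q : E := (‖x - y‖ / 2) • σ with hq
  have hpq : ⟪p, q⟫ = 0 := by
    rw [hp, hq, inner_smul_left, inner_smul_right, hxy, mul_zero, mul_zero]
  have hsum : x + y = p + q + (p - q) := by
    rw [hp]
    module
  rw [hf x y (p + q) (p - q) hsum ?_, hsum,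
    add_of_norm_eq (norm_add_eq_norm_sub_of_inner_eq_zero hpq)]
  rw [show p + q - (p - q) = ‖x - y‖ • σ by rw [hq]; module, norm_smul, hσ]
  simp

/-- A continuous even elastic invariant vanishing at the origin is a multiple of `‖x‖ ^ 2`. -/
lemma IsElasticInvariant.exists_eq_mul_norm_sq {f : E → ℝ} (hf : IsElasticInvariant f)
    (hc : Continuous f) (h0 : f 0 = 0) (heven : ∀ x, f (-x) = f x)
    (hperp : ∀ v : E, ∃ σ : E, ‖σ‖ = 1 ∧ ⟪v, σ⟫ = 0) :
    ∃ c : ℝ, ∀ x, f x = c * ‖x‖ ^ 2 := by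
  have radial {x y : E} (h : ‖x‖ = ‖y‖) : f x = f y := by
    have := hf x (-x) y (-y) (by simp) (by
      rw [sub_neg_eq_add, sub_neg_eq_add, ← two_smul ℝ x, ← two_smul ℝ y, norm_smul, norm_smul, h])
    rw [heven, heven] at this
    linarith
  obtain ⟨e, he, -⟩ := hperp 0
  obtain ⟨e', he', hee⟩ := hperp e
  have hn (s : ℝ) : ‖√s • e‖ = √s := by simp [norm_smul, he]
  refine ⟨f (√1 • e), fun x => ?_⟩
  rw [← eq_mul_of_additiveOn_Ici (h := fun s => f (√s • e))
    (Continuous.continuousOn (by fun_prop)) ?_ (sq_nonneg ‖x‖)]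
  · exact radial (by rw [hn, Real.sqrt_sq (norm_nonneg x)])
  · intro s t hs ht
    have hst : ⟪√s • e, √t • e'⟫ = 0 := by
      rw [inner_smul_left, inner_smul_right, hee, mul_zero, mul_zero]
    have hn' : ‖√t • e'‖ = √t := by simp [norm_smul, he']
    rw [radial (x := √t • e) (y := √t • e') (by rw [hn, hn']),
      ← hf.map_add_of_inner_eq_zero h0 hst]
    refine radial ?_
    rw [hn, ← sq_eq_sq₀ (Real.sqrt_nonneg _) (norm_nonneg _), norm_add_sq_real, hst, hn, hn',
      Real.sq_sqrt hs, Real.sq_sqrt ht, Real.sq_sqrt (add_nonneg hs ht)]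
    ring

/-- The continuous elastic invariants are `1`, the momenta and the kinetic energy. -/
theorem IsElasticInvariant.exists_eq [CompleteSpace E] {f : E → ℝ} (hf : IsElasticInvariant f)
    (hc : Continuous f) (hperp : ∀ v : E, ∃ σ : E, ‖σ‖ = 1 ∧ ⟪v, σ⟫ = 0) :
    ∃ (a : ℝ) (b : E) (c : ℝ), ∀ x, f x = a + ⟪b, x⟫ + c * ‖x‖ ^ 2 := by
  have hodd : IsElasticInvariant fun x => (f x - f (-x)) / 2 := fun x y z w h₁ h₂ => by
    linarith [hf x y z w h₁ h₂, hf.comp_neg x y z w h₁ h₂]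
  have heven : IsElasticInvariant fun x => (f x + f (-x)) / 2 - f 0 := fun x y z w h₁ h₂ => by
    linarith [hf x y z w h₁ h₂, hf.comp_neg x y z w h₁ h₂]
  obtain ⟨c, hcx⟩ := heven.exists_eq_mul_norm_sq (by fun_prop) (by simp)
    (fun x => by rw [neg_neg, add_comm]) hperp
  let L : E →L[ℝ] ℝ := (AddMonoidHom.mk' (fun x => (f x - f (-x)) / 2)
    (hodd.map_add_of_odd (fun x => by rw [neg_neg]; ring) hperp)).toRealLinearMap
      (show Continuous fun x => (f x - f (-x)) / 2 by fun_prop)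
  refine ⟨f 0, (InnerProductSpace.toDual ℝ E).symm L, c, fun x => ?_⟩
  rw [InnerProductSpace.toDual_symm_apply, ← hcx]
  change f x = f 0 + (f x - f (-x)) / 2 + ((f x + f (-x)) / 2 - f 0)
  ring

end ElasticInvariant

lemma exists_unit_inner_eq_zero (v : V3) : ∃ σ : V3, ‖σ‖ = 1 ∧ ⟪v, σ⟫ = 0 := by
  have : Nontrivial (ℝ ∙ v)ᗮ := by
    apply Module.nontrivial_of_finrank_pos (R := ℝ)
    have h₁ := (ℝ ∙ v).finrank_add_finrank_orthogonal
    have h₂ := (finrank_span_le_card (R := ℝ) {v}).trans_eq (Set.toFinset_card {v})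
    rw [Set.card_singleton] at h₂
    rw [finrank_euclideanSpace_fin] at h₁
    omega
  obtain ⟨σ, hσ⟩ := exists_norm_eq (ℝ ∙ v)ᗮ zero_le_one
  exact ⟨σ, hσ, Submodule.mem_orthogonal_singleton_iff_inner_right.1 σ.2⟩

/-- Every pair of velocities with the same total momentum and relative speed is reached by a
resonant collision. -/
lemma exists_xiPrimeRes_eq {x y z w : V3} (h₁ : x + y = z + w) (h₂ : ‖x - y‖ = ‖z - w‖) :
    ∃ σ : Sph, xiPrimeRes x y σ = z ∧ xiStarPrimeRes x y σ = w := by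
  obtain ⟨σ, hσ⟩ : ∃ σ : Sph, ‖z - w‖ • (σ : V3) = z - w := by
    by_cases h : z - w = 0
    · obtain ⟨σ, hσ, -⟩ := exists_unit_inner_eq_zero 0
      exact ⟨⟨σ, by simpa using hσ⟩, by simp [h]⟩
    · refine ⟨⟨‖z - w‖⁻¹ • (z - w), by simp [norm_smul, h]⟩, ?_⟩
      exact smul_inv_smul₀ (norm_ne_zero_iff.2 h) _
  have hσ' : (‖x - y‖ / 2) • (σ : V3) = (1 / 2 : ℝ) • (z - w) := by
    rw [← hσ, h₂]
    module
  refine ⟨σ, ?_, ?_⟩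
  · rw [xiPrimeRes, hσ', h₁]
    module
  · rw [xiStarPrimeRes, hσ', h₁]
    module

/-- characterization of resonant collision invariants. -/
theorem resonant_collision_invariants (m : ℝ) (hm : 0 < m)
    (g : V3 → ℝ → ℝ)
    (hg : ContinuousOn (Function.uncurry g) (Set.univ ×ˢ Set.Ici (0:ℝ)))
    (hinv : ∀ (ξ ξs : V3) (I Is r : ℝ) (σ : Sph),
      0 ≤ I → 0 ≤ Is → r ∈ Set.Icc (0:ℝ) 1 →
      g ξ I + g ξs Is =
        g (xiPrimeRes ξ ξs σ) (IPrimeRes I Is r) +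
          g (xiStarPrimeRes ξ ξs σ) (IStarPrimeRes I Is r)) :
    ∃ (a : ℝ) (b : V3) (c d : ℝ), ∀ (ξ : V3) (I : ℝ), 0 ≤ I →
      g ξ I = a + ⟪b, ξ⟫ + c * ‖ξ‖ ^ 2 + d * I := by
  have hcoll {x y z w : V3} (h₁ : x + y = z + w) (h₂ : ‖x - y‖ = ‖z - w‖) {I Is r : ℝ}
      (hI : 0 ≤ I) (hIs : 0 ≤ Is) (hr : r ∈ Set.Icc (0 : ℝ) 1) :
      g x I + g y Is = g z (r * (I + Is)) + g w ((1 - r) * (I + Is)) := by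
    obtain ⟨σ, rfl, rfl⟩ := exists_xiPrimeRes_eq h₁ h₂
    exact hinv x y I Is r σ hI hIs hr
  have hf : IsElasticInvariant fun x => g x 0 := fun x y z w h₁ h₂ => by
    simpa using hcoll h₁ h₂ (I := 0) (Is := 0) (r := 0) le_rfl le_rfl (by simp)
  have hfc : Continuous fun x => g x 0 :=
    hg.comp_continuous (f := fun x : V3 => (x, (0 : ℝ))) (by fun_prop) (by simp)
  have hlin (x : V3) (I : ℝ) (hI : 0 ≤ I) : g x I - g x 0 = (g x 1 - g x 0) * I := by
    refine eq_mul_of_additiveOn_Ici (h := fun t => g x t - g x 0) ?_ ?_ hI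
    · refine ContinuousOn.sub ?_ continuousOn_const
      exact hg.comp (f := fun t : ℝ => (x, t)) (by fun_prop) fun t ht => by simpa using ht
    · intro s t hs ht
      have := hcoll (x := x) (y := x) rfl rfl hs ht (r := 1) (by simp)
      simp only [one_mul, sub_self, zero_mul] at this
      linarith
  have hconst (x : V3) : g x 1 - g x 0 = g 0 1 - g 0 0 := by
    have := hcoll (x := x) (y := 0) rfl rfl (I := 1) (Is := 0) (r := 0)
      zero_le_one le_rfl (by simp)
    simp only [zero_mul, sub_zero, add_zero, one_mul] at this
    linarith
  obtain ⟨a, b, c, habc⟩ := hf.exists_eq hfc exists_unit_inner_eq_zero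
  refine ⟨a, b, c, g 0 1 - g 0 0, fun ξ I hI => ?_⟩
  rw [← habc ξ, ← hconst ξ, ← hlin ξ I hI]
  ring
end
end

section
/- Characterization of standard (non-resonant) collision invariants: let g : ℝ³ × [0,∞) → ℝ be continuous and suppose that g(ξ,I) + g(ξ_*,I_*) = g(ξ',I') + g(ξ_*',I_*') for all ξ, ξ_* ∈ ℝ³, I, I_* ≥ 0, R, r ∈ [0,1], σ ∈ S², where (ξ', ξ_*', I', I_*') are the standard Borgnakke–Larsen collision variables. Then there exist a ∈ ℝ, b ∈ ℝ³, c ∈ ℝ such that g(ξ,I) = a + b·ξ + c(m|ξ|² + 2I) for all ξ ∈ ℝ³ and I ≥ 0. -/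
noncomputable section

open MeasureTheory Real
open scoped BigOperators RealInnerProductSpace

/-- A continuous solution of Cauchy's functional equation on `[0,∞)` is linear. -/
theorem eq_mul_of_additive_on_nonneg {h : ℝ → ℝ} (hc : ContinuousOn h (Set.Ici 0))
    (hadd : ∀ x y, 0 ≤ x → 0 ≤ y → h (x + y) = h x + h y) {x : ℝ} (hx : 0 ≤ x) :
    h x = x * h 1 := by
  have h0 : h 0 = 0 := by simpa using hadd 0 0 le_rfl le_rfl
  let F : ℝ →+ ℝ := AddMonoidHom.mk' (fun x => h (max x 0) - h (max (-x) 0)) (by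
    intro x y
    have e : max (x + y) 0 + (max (-x) 0 + max (-y) 0) =
        max (-(x + y)) 0 + (max x 0 + max y 0) := by
      grind
    have e' := congrArg h e
    rw [hadd _ _ (by positivity) (by positivity), hadd _ _ (by positivity) (by positivity),
      hadd _ _ (by positivity) (by positivity), hadd _ _ (by positivity) (by positivity)] at e'
    linarith)
  have hF : Continuous F :=
    (hc.comp_continuous (f := fun x : ℝ => max x 0) (by fun_prop)
      fun x => Set.mem_Ici.mpr (le_max_right _ _)).sub
    (hc.comp_continuous (f := fun x : ℝ => max (-x) 0) (by fun_prop)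
      fun x => Set.mem_Ici.mpr (le_max_right _ _))
  have hval : ∀ y : ℝ, 0 ≤ y → F y = h y := by
    intro y hy
    change h (max y 0) - h (max (-y) 0) = h y
    rw [max_eq_left hy, max_eq_right (by linarith), h0, sub_zero]
  have := map_real_smul F hF x 1
  rwa [smul_eq_mul, smul_eq_mul, mul_one, hval x hx, hval 1 zero_le_one] at this

/-- A continuous solution of Jensen's functional equation on a real Hilbert space is affine. -/
theorem exists_eq_add_inner_of_jensen {E : Type*} [NormedAddCommGroup E] [InnerProductSpace ℝ E]
    [CompleteSpace E] {q : E → ℝ} (hc : Continuous q)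
    (hq : ∀ x y, q x + q y = 2 * q ((1 / 2 : ℝ) • (x + y))) :
    ∃ (a : ℝ) (b : E), ∀ x, q x = a + ⟪b, x⟫ := by
  let F : E →+ ℝ := AddMonoidHom.mk' (fun x => q x - q 0) (by
    intro x y
    have h1 := hq x y
    have h2 := hq (x + y) 0
    rw [add_zero] at h2
    linarith)
  have hF : Continuous F := hc.sub continuous_const
  refine ⟨q 0, (InnerProductSpace.toDual ℝ E).symm (F.toRealLinearMap hF), fun x => ?_⟩
  rw [InnerProductSpace.toDual_symm_apply]
  change q x = q 0 + (q x - q 0)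
  ring

/-- characterization of standard (non-resonant) collision invariants. -/
theorem standard_collision_invariants (m : ℝ) (hm : 0 < m)
    (g : V3 → ℝ → ℝ)
    (hg : ContinuousOn (Function.uncurry g) (Set.univ ×ˢ Set.Ici (0:ℝ)))
    (hinv : ∀ (ξ ξs : V3) (I Is R r : ℝ) (σ : Sph),
      0 ≤ I → 0 ≤ Is → R ∈ Set.Icc (0:ℝ) 1 → r ∈ Set.Icc (0:ℝ) 1 →
      g ξ I + g ξs Is =
        g (xiPrimeStd m ξ ξs I Is R σ) (IPrimeStd m ξ ξs I Is R r) +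
          g (xiStarPrimeStd m ξ ξs I Is R σ) (IStarPrimeStd m ξ ξs I Is R r)) :
    ∃ (a : ℝ) (b : V3) (c : ℝ), ∀ (ξ : V3) (I : ℝ), 0 ≤ I →
      g ξ I = a + ⟪b, ξ⟫ + c * (m * ‖ξ‖ ^ 2 + 2 * I) := by
  have key : ∀ (ξ ξs : V3) (I Is : ℝ), 0 ≤ I → 0 ≤ Is → g ξ I + g ξs Is =
      g ((1 / 2 : ℝ) • (ξ + ξs)) 0 +
        g ((1 / 2 : ℝ) • (ξ + ξs)) (m / 4 * ‖ξ - ξs‖ ^ 2 + I + Is) := by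
    intro ξ ξs I Is hI hIs
    obtain ⟨σ, hσ⟩ : (Metric.sphere (0 : V3) 1).Nonempty :=
      NormedSpace.sphere_nonempty.mpr zero_le_one
    simpa [xiPrimeStd, xiStarPrimeStd, IPrimeStd, IStarPrimeStd, collE] using
      hinv ξ ξs I Is 0 0 ⟨σ, hσ⟩ hI hIs (by simp) (by simp)
  have mid : ∀ V : V3, (1 / 2 : ℝ) • (V + V) = V := by
    intro V
    rw [← two_smul ℝ V, smul_smul]
    norm_num
  have lin : ∀ (V : V3) (I : ℝ), 0 ≤ I → g V I = g V 0 + I * (g V 1 - g V 0) := by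
    intro V I hI
    have hcont : ContinuousOn (fun J => g V J - g V 0) (Set.Ici 0) :=
      (hg.comp (f := fun J : ℝ => (V, J)) (by fun_prop) fun J hJ => ⟨trivial, hJ⟩).sub
        continuousOn_const
    have := eq_mul_of_additive_on_nonneg hcont (fun x y hx hy => by
      have := key V V x y hx hy
      rw [mid, sub_self, norm_zero] at this
      norm_num at this
      linarith) hI
    linarith
  have slope : ∀ ξ, g ξ 1 - g ξ 0 = g 0 1 - g 0 0 := by
    have half : ∀ ξ ξs : V3, g ξ 1 - g ξ 0 =
        g ((1 / 2 : ℝ) • (ξ + ξs)) 1 - g ((1 / 2 : ℝ) • (ξ + ξs)) 0 := by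
      intro ξ ξs
      have h1 := key ξ ξs 1 0 zero_le_one le_rfl
      have h0 := key ξ ξs 0 0 le_rfl le_rfl
      rw [lin _ (_ + _ + _) (by positivity)] at h1 h0
      linarith
    intro ξ
    rw [half ξ 0, half 0 ξ, add_comm]
  set k := g 0 1 - g 0 0
  have hc : Continuous fun ξ => g ξ 0 - k * m / 2 * ‖ξ‖ ^ 2 :=
    (hg.comp_continuous (f := fun ξ : V3 => (ξ, (0 : ℝ))) (by fun_prop)
      fun ξ => ⟨trivial, Set.self_mem_Ici⟩).sub (by fun_prop)
  obtain ⟨a, b, hab⟩ := exists_eq_add_inner_of_jensen hc (by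
    intro x y
    have h0 := key x y 0 0 le_rfl le_rfl
    rw [lin _ (_ + _ + _) (by positivity), slope] at h0
    have hn : ‖(1 / 2 : ℝ) • (x + y)‖ ^ 2 = 1 / 4 * ‖x + y‖ ^ 2 := by
      rw [norm_smul, mul_pow]
      norm_num
    have hp := parallelogram_law_with_norm ℝ x y
    rw [hn]
    linear_combination h0 + k * m / 4 * hp)
  refine ⟨a, b, k / 2, fun ξ I hI => ?_⟩
  have := hab ξ
  rw [lin ξ I hI, slope]
  linear_combination this
end
end

section
/- The standard and resonant collision frequencies agree and have an explicit form: for every ξ ∈ ℝ³ and I ≥ 0, ∫_{[0,1]²×S²×ℝ³×[0,∞)} C_s (I+I_*)^α |ξ−ξ_*|^β M_r(ξ_*,I_*) R^{(β+1)/2} (1−R)^{δ+α−1} [r(1−r)]^{δ/2−1} dR dr dσ dξ_* dI_* = ∫_{[0,1]×S²×ℝ³×[0,∞)} C_r (I+I_*)^α |ξ−ξ_*|^β M_r(ξ_*,I_*) [r(1−r)]^{δ/2−1} dr dσ dξ_* dI_* = 4π C_r (Γ(δ/2)² / Γ(δ)) ∫_{ℝ³×[0,∞)} (I+I_*)^α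 |ξ−ξ_*|^β M_r(ξ_*,I_*) dξ_* dI_*. -/
noncomputable section

open MeasureTheory Real
open scoped BigOperators RealInnerProductSpace

/-- Euler's beta integral for real parameters. -/
lemma integral_Icc_rpow_mul_one_sub_rpow {a b : ℝ} (ha : 0 < a) (hb : 0 < b) :
    ∫ x in Set.Icc (0 : ℝ) 1, x ^ (a - 1) * (1 - x) ^ (b - 1) =
      Real.Gamma a * Real.Gamma b / Real.Gamma (a + b) := by
  rw [integral_Icc_eq_integral_Ioc, ← intervalIntegral.integral_of_le zero_le_one]
  change _ = ProbabilityTheory.beta a b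
  have h : ((∫ x in (0 : ℝ)..1, x ^ (a - 1) * (1 - x) ^ (b - 1) : ℝ) : ℂ) =
      Complex.betaIntegral a b := by
    rw [← intervalIntegral.integral_ofReal, Complex.betaIntegral]
    refine intervalIntegral.integral_congr fun x hx => ?_
    rw [Set.uIcc_of_le zero_le_one] at hx
    have h1 : 0 ≤ 1 - x := sub_nonneg.2 hx.2
    simp only [Complex.ofReal_mul, Complex.ofReal_cpow hx.1, Complex.ofReal_cpow h1]
    push_cast
    rfl
  rw [ProbabilityTheory.beta_eq_betaIntegralReal a b ha hb, ← h, Complex.ofReal_re]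

lemma integral_Icc_mul_one_sub_rpow {a : ℝ} (ha : 0 < a) :
    ∫ r in Set.Icc (0 : ℝ) 1, (r * (1 - r)) ^ (a - 1) =
      Real.Gamma a ^ 2 / Real.Gamma (2 * a) := by
  rw [sq, two_mul, ← integral_Icc_rpow_mul_one_sub_rpow ha ha]
  exact setIntegral_congr_fun measurableSet_Icc fun r hr =>
    Real.mul_rpow hr.1 (sub_nonneg.2 hr.2)

lemma sphMeasure_real_univ : sphMeasure.real Set.univ = 4 * π := by
  rw [sphMeasure, Measure.toSphere_real_apply_univ, measureReal_def,
    EuclideanSpace.volume_ball_fin_three]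
  simp only [finrank_euclideanSpace, Fintype.card_fin, ENNReal.ofReal_one, one_pow, one_mul,
    ENNReal.toReal_ofReal (show (0 : ℝ) ≤ π * 4 / 3 by positivity)]
  push_cast
  ring

/-- the standard and resonant collision frequencies agree and have an
explicit form. -/
theorem collision_frequencies_eq (m kB δ α β Cr Cs : ℝ) (hm : 0 < m) (hkB : 0 < kB) (hδ : 2 ≤ δ)
    (hα : α ∈ Set.Ico (0:ℝ) (δ / 2)) (hβ : β ∈ Set.Icc (0:ℝ) 1) (hCr : 0 < Cr)
    (hCs : Cs = Real.Gamma (δ + α + (β + 3) / 2) /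
      (Real.Gamma ((β + 3) / 2) * Real.Gamma (δ + α)) * Cr)
    (n Ttr Tint : ℝ) (hn : 0 < n) (hTtr : 0 < Ttr) (hTint : 0 < Tint) (u : V3) :
    ∀ (ξ : V3) (I : ℝ), 0 ≤ I →
      (∫ Is in Set.Ici (0:ℝ), ∫ ξs : V3,
          (∫ σ : Sph, (∫ r in Set.Icc (0:ℝ) 1, ∫ R in Set.Icc (0:ℝ) 1,
            Cs * (I + Is) ^ α * ‖ξ - ξs‖ ^ β * Mr m kB δ n Ttr Tint u ξs Is *
              R ^ ((β + 1) / 2) * (1 - R) ^ (δ + α - 1) * (r * (1 - r)) ^ (δ / 2 - 1))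
            ∂sphMeasure)) =
        (∫ Is in Set.Ici (0:ℝ), ∫ ξs : V3,
          (∫ σ : Sph, (∫ r in Set.Icc (0:ℝ) 1,
            Cr * (I + Is) ^ α * ‖ξ - ξs‖ ^ β * Mr m kB δ n Ttr Tint u ξs Is *
              (r * (1 - r)) ^ (δ / 2 - 1)) ∂sphMeasure)) ∧
      (∫ Is in Set.Ici (0:ℝ), ∫ ξs : V3,
          (∫ σ : Sph, (∫ r in Set.Icc (0:ℝ) 1,
            Cr * (I + Is) ^ α * ‖ξ - ξs‖ ^ β * Mr m kB δ n Ttr Tint u ξs Is *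
              (r * (1 - r)) ^ (δ / 2 - 1)) ∂sphMeasure)) =
        4 * π * Cr * (Real.Gamma (δ / 2) ^ 2 / Real.Gamma δ) *
          ∫ Is in Set.Ici (0:ℝ), ∫ ξs : V3,
            (I + Is) ^ α * ‖ξ - ξs‖ ^ β * Mr m kB δ n Ttr Tint u ξs Is := by
  intro ξ I _
  have hst : ∀ A : ℝ, ∀ r : ℝ, (∫ R in Set.Icc (0 : ℝ) 1,
      Cs * A * R ^ ((β + 1) / 2) * (1 - R) ^ (δ + α - 1) * (r * (1 - r)) ^ (δ / 2 - 1)) =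
      Cr * A * (r * (1 - r)) ^ (δ / 2 - 1) := by
    intro A r
    have hβ' : 0 < (β + 3) / 2 := by linarith [hβ.1]
    have hδα : 0 < δ + α := by linarith [hα.1]
    have hB := integral_Icc_rpow_mul_one_sub_rpow hβ' hδα
    rw [show (β + 3) / 2 - 1 = (β + 1) / 2 by ring] at hB
    have g1 := (Real.Gamma_pos_of_pos hβ').ne'
    have g2 := (Real.Gamma_pos_of_pos hδα).ne'
    have g3 := (Real.Gamma_pos_of_pos (add_pos hδα hβ')).ne'
    have hsplit : ∀ R : ℝ,
        Cs * A * R ^ ((β + 1) / 2) * (1 - R) ^ (δ + α - 1) * (r * (1 - r)) ^ (δ / 2 - 1) =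
          Cs * A * (R ^ ((β + 1) / 2) * (1 - R) ^ (δ + α - 1)) * (r * (1 - r)) ^ (δ / 2 - 1) :=
      fun R => by ring
    simp_rw [hsplit]
    rw [integral_mul_const, integral_const_mul, hB, hCs, add_comm ((β + 3) / 2)]
    generalize Real.Gamma (δ + α + (β + 3) / 2) = G at g3 ⊢
    field_simp
  have hr : ∀ A : ℝ, (∫ _ : Sph, (∫ r in Set.Icc (0 : ℝ) 1,
      Cr * A * (r * (1 - r)) ^ (δ / 2 - 1)) ∂sphMeasure) =
      4 * π * Cr * (Real.Gamma (δ / 2) ^ 2 / Real.Gamma δ) * A := by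
    intro A
    rw [integral_const, sphMeasure_real_univ, integral_const_mul,
      integral_Icc_mul_one_sub_rpow (by linarith), mul_div_cancel₀ δ two_ne_zero, smul_eq_mul]
    ring
  constructor
  · refine integral_congr_ae (.of_forall fun Is => integral_congr_ae (.of_forall fun ξs =>
      integral_congr_ae (.of_forall fun σ => integral_congr_ae (.of_forall fun r => ?_))))
    simpa only [mul_assoc] using
      hst ((I + Is) ^ α * ‖ξ - ξs‖ ^ β * Mr m kB δ n Ttr Tint u ξs Is) r
  · rw [← integral_const_mul]
    refine integral_congr_ae (.of_forall fun Is => ?_)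
    beta_reduce
    rw [← integral_const_mul]
    refine integral_congr_ae (.of_forall fun ξs => ?_)
    simpa only [mul_assoc] using
      hr ((I + Is) ^ α * ‖ξ - ξs‖ ^ β * Mr m kB δ n Ttr Tint u ξs Is)
end
end

section
/- Two-sided bounds on the collision frequency: there exist constants ν⁻ and ν⁺ with 0 < ν⁻ < ν⁺ such that for all ξ ∈ ℝ³ and all I ≥ 0, ν⁻ (1+|ξ|)^β (1+I)^α ≤ ∫_{ℝ³×[0,∞)} (I+I_*)^α |ξ−ξ_*|^β M_r(ξ_*,I_*) dξ_* dI_* ≤ ν⁺ (1+|ξ|)^β (1+I)^α. -/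
noncomputable section

open MeasureTheory Real
open scoped BigOperators RealInnerProductSpace

theorem one_add_norm_sub_le {V : Type*} [SeminormedAddCommGroup V] (x y : V) :
    1 + ‖x - y‖ ≤ (1 + ‖x‖) * (1 + ‖y‖) := by
  nlinarith [norm_sub_le x y, norm_nonneg x, norm_nonneg y,
    mul_nonneg (norm_nonneg x) (norm_nonneg y)]

theorem one_add_norm_mul_min_rpow_le {V : Type*} [SeminormedAddCommGroup V] [NormedSpace ℝ V]
    {β : ℝ} (hβ : 0 ≤ β) (z w : V) :
    (1 + ‖z‖) ^ β * (min 1 ‖w‖ / 2) ^ β ≤ ‖z - w‖ ^ β + ‖z + w‖ ^ β := by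
  have hz : 2 * ‖z‖ ≤ ‖z - w‖ + ‖z + w‖ := by
    have h := norm_add_le (z - w) (z + w)
    rwa [show z - w + (z + w) = (2 : ℝ) • z by rw [two_smul]; abel, norm_smul,
      Real.norm_ofNat] at h
  have hw : 2 * ‖w‖ ≤ ‖z - w‖ + ‖z + w‖ := by
    have h := norm_sub_le (z + w) (z - w)
    rw [show z + w - (z - w) = (2 : ℝ) • w by rw [two_smul]; abel, norm_smul,
      Real.norm_ofNat] at h
    linarith
  have hmin : (1 + ‖z‖) * (min 1 ‖w‖ / 2) ≤ max ‖z - w‖ ‖z + w‖ := by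
    have h1 := le_max_left ‖z - w‖ ‖z + w‖
    have h2 := le_max_right ‖z - w‖ ‖z + w‖
    nlinarith [min_le_left 1 ‖w‖, min_le_right 1 ‖w‖, norm_nonneg z]
  have hm0 : 0 ≤ min 1 ‖w‖ := le_min zero_le_one (norm_nonneg w)
  rw [← mul_rpow (by positivity) (by positivity)]
  refine (rpow_le_rpow (by positivity) hmin hβ).trans ?_
  have h1 : 0 ≤ ‖z - w‖ ^ β := by positivity
  have h2 : 0 ≤ ‖z + w‖ ^ β := by positivity
  rcases max_choice ‖z - w‖ ‖z + w‖ with h | h <;> rw [h] <;> linarith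

section Gaussian

variable {V : Type*} [NormedAddCommGroup V] [InnerProductSpace ℝ V] [FiniteDimensional ℝ V]
  [MeasurableSpace V] [BorelSpace V]

theorem integrable_exp_neg_mul_sq_norm {a : ℝ} (ha : 0 < a) :
    Integrable fun w : V => exp (-(a * ‖w‖ ^ 2)) := by
  have h := (GaussianFourier.integrable_cexp_neg_mul_sq_norm_add (V := V) (b := (a : ℂ))
    (by simpa using ha) 0 0).norm
  refine h.congr (.of_forall fun w => ?_)
  simp only [Complex.norm_exp]
  congr 1
  simp [← Complex.ofReal_pow]

theorem integrable_one_add_norm_rpow_mul_gaussian {a β : ℝ} (ha : 0 < a)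
    (hβ : β ∈ Set.Icc (0 : ℝ) 1) :
    Integrable fun w : V => (1 + ‖w‖) ^ β * exp (-(a * ‖w‖ ^ 2)) := by
  have hcont : Continuous fun w : V => (1 + ‖w‖) ^ β * exp (-(a * ‖w‖ ^ 2)) :=
    ((continuous_const.add continuous_norm).rpow_const fun _ => .inr hβ.1).mul (by fun_prop)
  refine ((integrable_exp_neg_mul_sq_norm (V := V) (half_pos ha)).const_mul
    (exp (1 / (2 * a)))).mono' hcont.aestronglyMeasurable (.of_forall fun w => ?_)
  have h1 : 1 ≤ 1 + ‖w‖ := by linarith [norm_nonneg w]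
  have hsq : ‖w‖ ≤ 1 / (2 * a) + a / 2 * ‖w‖ ^ 2 := by
    have : 1 / (2 * a) + a / 2 * ‖w‖ ^ 2 - ‖w‖ = (a * ‖w‖ - 1) ^ 2 / (2 * a) := by
      field_simp
      ring
    have : 0 ≤ (a * ‖w‖ - 1) ^ 2 / (2 * a) := by positivity
    linarith
  rw [Real.norm_of_nonneg (by positivity), ← exp_add]
  calc (1 + ‖w‖) ^ β * exp (-(a * ‖w‖ ^ 2))
      ≤ exp ‖w‖ * exp (-(a * ‖w‖ ^ 2)) := by
        gcongr
        calc (1 + ‖w‖) ^ β ≤ (1 + ‖w‖) ^ (1 : ℝ) := rpow_le_rpow_of_exponent_le h1 hβ.2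
          _ ≤ exp ‖w‖ := by rw [rpow_one, add_comm]; exact add_one_le_exp _
    _ ≤ _ := by
        rw [← exp_add]
        exact exp_le_exp.2 (by linarith)

theorem integral_norm_sub_rpow_mul_gaussian_bounds {a β : ℝ} (ha : 0 < a)
    (hβ : β ∈ Set.Icc (0 : ℝ) 1) [Nontrivial V] :
    ∃ c C : ℝ, 0 < c ∧ 0 ≤ C ∧ ∀ z : V,
      c * (1 + ‖z‖) ^ β ≤ ∫ w : V, ‖z - w‖ ^ β * exp (-(a * ‖w‖ ^ 2)) ∧
        ∫ w : V, ‖z - w‖ ^ β * exp (-(a * ‖w‖ ^ 2)) ≤ C * (1 + ‖z‖) ^ β := by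
  have hG := integrable_one_add_norm_rpow_mul_gaussian (V := V) ha hβ
  have hdom (z w : V) : ‖z - w‖ ^ β * exp (-(a * ‖w‖ ^ 2)) ≤
      (1 + ‖z‖) ^ β * ((1 + ‖w‖) ^ β * exp (-(a * ‖w‖ ^ 2))) := by
    rw [← mul_assoc, ← mul_rpow (by positivity) (by positivity)]
    gcongr
    · exact hβ.1
    · linarith [one_add_norm_sub_le z w]
  have h_int (z : V) : Integrable fun w : V => ‖z - w‖ ^ β * exp (-(a * ‖w‖ ^ 2)) := by
    have hcont : Continuous fun w : V => ‖z - w‖ ^ β * exp (-(a * ‖w‖ ^ 2)) :=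
      ((continuous_const.sub continuous_id).norm.rpow_const fun _ => .inr hβ.1).mul (by fun_prop)
    refine (hG.const_mul ((1 + ‖z‖) ^ β)).mono' hcont.aestronglyMeasurable
      (.of_forall fun w => ?_)
    rw [Real.norm_of_nonneg (by positivity)]
    exact hdom z w
  have hmin_nonneg (w : V) : 0 ≤ min 1 ‖w‖ / 2 :=
    div_nonneg (le_min zero_le_one (norm_nonneg w)) zero_le_two
  have hLcont : Continuous fun w : V => (min 1 ‖w‖ / 2) ^ β * exp (-(a * ‖w‖ ^ 2)) :=
    (((continuous_const.min continuous_norm).div_const 2).rpow_const fun _ => .inr hβ.1).mul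
      (by fun_prop)
  have hLint : Integrable fun w : V => (min 1 ‖w‖ / 2) ^ β * exp (-(a * ‖w‖ ^ 2)) := by
    refine hG.mono' hLcont.aestronglyMeasurable (.of_forall fun w => ?_)
    have h0 := hmin_nonneg w
    rw [Real.norm_of_nonneg (by positivity)]
    gcongr
    · exact hβ.1
    · linarith [min_le_left 1 ‖w‖, norm_nonneg w]
  obtain ⟨v, hv⟩ := exists_ne (0 : V)
  have hLpos : 0 < ∫ w : V, (min 1 ‖w‖ / 2) ^ β * exp (-(a * ‖w‖ ^ 2)) := by
    refine integral_pos_of_integrable_nonneg_nonzero (x := v) hLcont hLint (fun w => ?_) ?_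
    · exact mul_nonneg (rpow_nonneg (hmin_nonneg w) _) (exp_nonneg _)
    · have : 0 < min 1 ‖v‖ := lt_min one_pos (norm_pos_iff.2 hv)
      positivity
  refine ⟨(∫ w : V, (min 1 ‖w‖ / 2) ^ β * exp (-(a * ‖w‖ ^ 2))) / 2,
    ∫ w : V, (1 + ‖w‖) ^ β * exp (-(a * ‖w‖ ^ 2)), half_pos hLpos,
    integral_nonneg fun w => by positivity, fun z => ⟨?_, ?_⟩⟩
  · have h_int' : Integrable fun w : V => ‖z + w‖ ^ β * exp (-(a * ‖w‖ ^ 2)) := by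
      simpa using (h_int z).comp_neg
    have hrefl : ∫ w : V, ‖z + w‖ ^ β * exp (-(a * ‖w‖ ^ 2)) =
        ∫ w : V, ‖z - w‖ ^ β * exp (-(a * ‖w‖ ^ 2)) := by
      simpa using integral_neg_eq_self
        (fun w : V => ‖z - w‖ ^ β * exp (-(a * ‖w‖ ^ 2))) volume
    have hmono := integral_mono (hLint.const_mul ((1 + ‖z‖) ^ β)) ((h_int z).add h_int')
      fun w => by
        simp only [Pi.add_apply]
        rw [← mul_assoc, ← add_mul]
        exact mul_le_mul_of_nonneg_right (one_add_norm_mul_min_rpow_le hβ.1 z w) (exp_nonneg _)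
    rw [integral_const_mul, integral_add' (h_int z) h_int', hrefl] at hmono
    linarith
  · rw [mul_comm, ← integral_const_mul]
    exact integral_mono (h_int z) (hG.const_mul _) (hdom z)

end Gaussian

theorem integrableOn_rpow_mul_exp_neg_div {p b : ℝ} (hp : 0 ≤ p) (hb : 0 < b) :
    IntegrableOn (fun s : ℝ => s ^ p * exp (-(s / b))) (Set.Ici 0) := by
  rw [integrableOn_Ici_iff_integrableOn_Ioi]
  refine (integrableOn_rpow_mul_exp_neg_mul_rpow (s := p) (p := 1) (by linarith) one_pos
    (inv_pos.2 hb)).congr_fun (fun s _ => ?_) measurableSet_Ioi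
  simp only [rpow_one]
  congr 2
  ring

theorem integral_add_rpow_mul_gamma_density_bounds {p α b : ℝ} (hp : 0 ≤ p) (hα : 0 ≤ α)
    (hb : 0 < b) :
    ∃ c C : ℝ, 0 < c ∧ 0 ≤ C ∧ ∀ I : ℝ, 0 ≤ I →
      c * (1 + I) ^ α ≤ ∫ s in Set.Ici (0 : ℝ), (I + s) ^ α * (s ^ p * exp (-(s / b))) ∧
        ∫ s in Set.Ici (0 : ℝ), (I + s) ^ α * (s ^ p * exp (-(s / b))) ≤ C * (1 + I) ^ α := by
  have hcont {f : ℝ → ℝ} (hf : Continuous f) :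
      Continuous fun s => f s ^ α * (s ^ p * exp (-(s / b))) :=
    (hf.rpow_const fun _ => .inr hα).mul
      ((continuous_id.rpow_const fun _ => .inr hp).mul (by fun_prop))
  have hG : IntegrableOn (fun s : ℝ => (1 + s) ^ α * (s ^ p * exp (-(s / b)))) (Set.Ici 0) := by
    refine Integrable.mono' (((integrableOn_rpow_mul_exp_neg_div hp hb).add
      (integrableOn_rpow_mul_exp_neg_div (add_nonneg hα hp) hb)).const_mul (2 ^ α))
      (hcont (by fun_prop)).aestronglyMeasurable ?_
    refine (ae_restrict_mem measurableSet_Ici).mono fun s (hs : 0 ≤ s) => ?_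
    rw [Real.norm_of_nonneg (by positivity)]
    simp only [Pi.add_apply]
    have hmax : (1 + s) ^ α ≤ 2 ^ α * (1 + s ^ α) := by
      have h0 : 0 ≤ s ^ α := by positivity
      have h2 : 0 ≤ (2 : ℝ) ^ α := by positivity
      rcases le_total s 1 with h | h
      · have := rpow_le_rpow (by positivity) (show 1 + s ≤ 2 by linarith) hα
        nlinarith
      · have := rpow_le_rpow (by positivity) (show 1 + s ≤ 2 * s by linarith) hα
        rw [mul_rpow zero_le_two hs] at this
        nlinarith
    calc (1 + s) ^ α * (s ^ p * exp (-(s / b)))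
        ≤ 2 ^ α * (1 + s ^ α) * (s ^ p * exp (-(s / b))) := by gcongr
      _ = _ := by rw [rpow_add_of_nonneg hs hα hp]; ring
  have hdom {I s : ℝ} (hI : 0 ≤ I) (hs : 0 ≤ s) : (I + s) ^ α * (s ^ p * exp (-(s / b))) ≤
      (1 + I) ^ α * ((1 + s) ^ α * (s ^ p * exp (-(s / b)))) := by
    rw [← mul_assoc ((1 + I) ^ α), ← mul_rpow (by positivity) (by positivity)]
    gcongr
    nlinarith
  have h_int {I : ℝ} (hI : 0 ≤ I) :
      IntegrableOn (fun s : ℝ => (I + s) ^ α * (s ^ p * exp (-(s / b)))) (Set.Ici 0) := by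
    refine Integrable.mono' (hG.const_mul ((1 + I) ^ α))
      (hcont (by fun_prop)).aestronglyMeasurable ?_
    refine (ae_restrict_mem measurableSet_Ici).mono fun s (hs : 0 ≤ s) => ?_
    rw [Real.norm_of_nonneg (by positivity)]
    exact hdom hI hs
  have hLint : IntegrableOn (fun s : ℝ => (min 1 s) ^ α * (s ^ p * exp (-(s / b))))
      (Set.Ici 0) := by
    refine Integrable.mono' hG (hcont (by fun_prop)).aestronglyMeasurable ?_
    refine (ae_restrict_mem measurableSet_Ici).mono fun s (hs : 0 ≤ s) => ?_
    have h0 : 0 ≤ min 1 s := le_min zero_le_one hs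
    rw [Real.norm_of_nonneg (by positivity)]
    gcongr
    linarith [min_le_left 1 s]
  have hLpos : 0 < ∫ s in Set.Ici (0 : ℝ), (min 1 s) ^ α * (s ^ p * exp (-(s / b))) := by
    rw [setIntegral_pos_iff_support_of_nonneg_ae _ hLint]
    · refine lt_of_lt_of_le ?_ (measure_mono (s := Set.Ioi (0 : ℝ)) fun s (hs : 0 < s) => ?_)
      · simp
      · have : 0 < min 1 s := lt_min one_pos hs
        exact ⟨by rw [Function.mem_support]; positivity, hs.le⟩
    · refine (ae_restrict_mem measurableSet_Ici).mono fun s (hs : 0 ≤ s) => ?_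
      have h0 : 0 ≤ min 1 s := le_min zero_le_one hs
      simp only [Pi.zero_apply]
      positivity
  refine ⟨_, ∫ s in Set.Ici (0 : ℝ), (1 + s) ^ α * (s ^ p * exp (-(s / b))), hLpos,
    setIntegral_nonneg measurableSet_Ici fun s (hs : 0 ≤ s) => by positivity,
    fun I hI => ⟨?_, ?_⟩⟩
  · rw [mul_comm, ← integral_const_mul]
    refine setIntegral_mono_on (hLint.const_mul _) (h_int hI) measurableSet_Ici
      fun s (hs : 0 ≤ s) => ?_
    have h0 : 0 ≤ min 1 s := le_min zero_le_one hs
    rw [← mul_assoc ((1 + I) ^ α), ← mul_rpow (by positivity) h0]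
    gcongr
    nlinarith [min_le_left 1 s, min_le_right 1 s]
  · rw [mul_comm, ← integral_const_mul]
    exact setIntegral_mono_on (h_int hI) (hG.const_mul _) measurableSet_Ici
      fun s hs => hdom hI hs

theorem integral_kernel_mul_Mr (m kB δ α β n Ttr Tint : ℝ) (u ξ : V3) (I : ℝ) :
    (∫ Is in Set.Ici (0:ℝ), ∫ ξs : V3,
      (I + Is) ^ α * ‖ξ - ξs‖ ^ β * Mr m kB δ n Ttr Tint u ξs Is) =
    n / ((2 * π * kB * Ttr / m) ^ ((3 : ℝ) / 2) * (kB * Tint) ^ (δ / 2) * Real.Gamma (δ / 2)) *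
      (∫ w : V3, ‖(ξ - u) - w‖ ^ β * exp (-(m / (2 * kB * Ttr) * ‖w‖ ^ 2))) *
      ∫ s in Set.Ici (0 : ℝ), (I + s) ^ α * (s ^ (δ / 2 - 1) * exp (-(s / (kB * Tint)))) := by
  rw [← integral_const_mul]
  congr 1 with Is
  rw [← integral_add_right_eq_self _ u, mul_assoc, mul_comm (∫ w : V3, _), ← mul_assoc,
    ← integral_const_mul]
  congr 1 with w
  have hexp : exp (-(m * ‖w + u - u‖ ^ 2) / (2 * kB * Ttr) - Is / (kB * Tint)) =
      exp (-(m / (2 * kB * Ttr) * ‖w‖ ^ 2)) * exp (-(Is / (kB * Tint))) := by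
    rw [← exp_add, add_sub_cancel_right]
    congr 1
    ring
  rw [Mr, hexp, show ξ - (w + u) = ξ - u - w by abel]
  ring

/-- two-sided bounds on the collision frequency. -/
theorem collision_frequency_bounds (m kB δ α β : ℝ)
    (hm : 0 < m) (hkB : 0 < kB) (hδ : 2 ≤ δ)
    (hα : α ∈ Set.Ico (0:ℝ) (δ / 2)) (hβ : β ∈ Set.Icc (0:ℝ) 1)
    (n Ttr Tint : ℝ) (hn : 0 < n) (hTtr : 0 < Ttr) (hTint : 0 < Tint) (u : V3) :
    ∃ νm νp : ℝ, 0 < νm ∧ νm < νp ∧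
      ∀ (ξ : V3) (I : ℝ), 0 ≤ I →
        νm * (1 + ‖ξ‖) ^ β * (1 + I) ^ α ≤
          (∫ Is in Set.Ici (0:ℝ), ∫ ξs : V3,
            (I + Is) ^ α * ‖ξ - ξs‖ ^ β * Mr m kB δ n Ttr Tint u ξs Is) ∧
        (∫ Is in Set.Ici (0:ℝ), ∫ ξs : V3,
            (I + Is) ^ α * ‖ξ - ξs‖ ^ β * Mr m kB δ n Ttr Tint u ξs Is) ≤
          νp * (1 + ‖ξ‖) ^ β * (1 + I) ^ α := by
  obtain ⟨c₁, C₁, hc₁, hC₁, h₁⟩ := integral_norm_sub_rpow_mul_gaussian_bounds (V := V3)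
    (a := m / (2 * kB * Ttr)) (by positivity) hβ
  obtain ⟨c₂, C₂, hc₂, hC₂, h₂⟩ := integral_add_rpow_mul_gamma_density_bounds
    (p := δ / 2 - 1) (by linarith) hα.1 (mul_pos hkB hTint)
  have hΓ : 0 < Real.Gamma (δ / 2) := Real.Gamma_pos_of_pos (by linarith)
  set K : ℝ := n / ((2 * π * kB * Ttr / m) ^ ((3 : ℝ) / 2) * (kB * Tint) ^ (δ / 2) *
    Real.Gamma (δ / 2)) with hK
  have hKpos : 0 < K := by positivity
  set U : ℝ := (1 + ‖u‖) ^ β with hU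
  have hUpos : 0 < U := by positivity
  refine ⟨K * (c₁ / U) * c₂, K * (c₁ / U) * c₂ + K * (C₁ * U) * C₂ + 1, by positivity,
    by have : 0 ≤ K * (C₁ * U) * C₂ := by positivity
       linarith, fun ξ I hI => ?_⟩
  rw [integral_kernel_mul_Mr, ← hK]
  obtain ⟨hl₁, hr₁⟩ := h₁ (ξ - u)
  obtain ⟨hl₂, hr₂⟩ := h₂ I hI
  have hle : (1 + ‖ξ‖) ^ β ≤ U * (1 + ‖ξ - u‖) ^ β := by
    rw [hU, ← mul_rpow (by positivity) (by positivity)]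
    have h := one_add_norm_sub_le (ξ - u) (-u)
    rw [sub_neg_eq_add, sub_add_cancel, norm_neg, mul_comm] at h
    exact rpow_le_rpow (by positivity) h hβ.1
  have hge : (1 + ‖ξ - u‖) ^ β ≤ U * (1 + ‖ξ‖) ^ β := by
    rw [hU, ← mul_rpow (by positivity) (by positivity), mul_comm (1 + ‖u‖)]
    exact rpow_le_rpow (by positivity) (one_add_norm_sub_le ξ u) hβ.1
  set A := ∫ w : V3, ‖(ξ - u) - w‖ ^ β * exp (-(m / (2 * kB * Ttr) * ‖w‖ ^ 2))
  set B := ∫ s in Set.Ici (0 : ℝ), (I + s) ^ α * (s ^ (δ / 2 - 1) * exp (-(s / (kB * Tint))))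
  have hA : c₁ / U * (1 + ‖ξ‖) ^ β ≤ A := by
    refine le_trans ?_ hl₁
    rw [div_mul_eq_mul_div, div_le_iff₀ hUpos]
    nlinarith
  have hA' : A ≤ C₁ * U * (1 + ‖ξ‖) ^ β := by
    refine hr₁.trans ?_
    rw [mul_assoc]
    gcongr
  have hA0 : 0 ≤ A := le_trans (by positivity) hA
  have hB0 : 0 ≤ B := le_trans (by positivity) hl₂
  constructor
  · calc K * (c₁ / U) * c₂ * (1 + ‖ξ‖) ^ β * (1 + I) ^ α
        = K * (c₁ / U * (1 + ‖ξ‖) ^ β) * (c₂ * (1 + I) ^ α) := by ring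
      _ ≤ K * A * B := by gcongr
  · calc K * A * B ≤ K * (C₁ * U * (1 + ‖ξ‖) ^ β) * (C₂ * (1 + I) ^ α) := by gcongr
      _ = K * (C₁ * U) * C₂ * (1 + ‖ξ‖) ^ β * (1 + I) ^ α := by ring
      _ ≤ _ := by
        gcongr
        have : 0 ≤ K * (c₁ / U) * c₂ := by positivity
        linarith
end
end
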